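/- arXiv:2304.11991 — 2 statements merged into one kernel-verified Lean document; each statement's English description precedes it below -/
import Mathlib

section
/- Let n ≥ 3 be an integer such that n is not an odd square plus one (n ≠ m²+1 for any odd positive integer m), let a_1,…,a_{n−2} ∈ ℤ, and let c ∈ ℚ. Then the polynomial z² − Δ(a_1,…,a_{n−2}, a_{n−1}, c), regarded as a polynomial in the two variables z and a_{n−1} over ℚ, is irreducible over ℚ. -/
open Polynomial

/-- The product of all squared differences is, up to sign, the product of the values of the
derivative at the roots. -/
theorem prod_sq_sub_eq_prod_derivative {R : Type*} [CommRing R] {n : ℕ} (α : Fin n → R) :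
    ∏ p ∈ Finset.univ.filter (fun p : Fin n × Fin n => p.1 < p.2), (α p.1 - α p.2) ^ 2 =
      (-1) ^ (Finset.univ.filter (fun p : Fin n × Fin n => p.1 < p.2)).card *
        ∏ i, ∏ j ∈ Finset.univ.erase i, (α i - α j) := by
  have hprod : ∏ i, ∏ j ∈ Finset.univ.erase i, (α i - α j) =
      ∏ p ∈ Finset.univ.filter (fun p : Fin n × Fin n => p.1 ≠ p.2), (α p.1 - α p.2) := by
    rw [Finset.prod_filter, ← Finset.univ_product_univ, Finset.prod_product]
    refine Finset.prod_congr rfl fun i _ => ?_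
    rw [← Finset.prod_filter]
    refine Finset.prod_congr ?_ fun _ _ => rfl
    ext j
    simp [eq_comm]
  have hsplit : (Finset.univ.filter fun p : Fin n × Fin n => p.1 ≠ p.2) =
      (Finset.univ.filter fun p : Fin n × Fin n => p.1 < p.2) ∪
        (Finset.univ.filter fun p : Fin n × Fin n => p.2 < p.1) := by
    ext p
    simp
  have hdisj : Disjoint (Finset.univ.filter fun p : Fin n × Fin n => p.1 < p.2)
      (Finset.univ.filter fun p : Fin n × Fin n => p.2 < p.1) := by
    rw [Finset.disjoint_filter]
    exact fun p _ h => h.asymm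
  have hswap : ∏ p ∈ Finset.univ.filter (fun p : Fin n × Fin n => p.2 < p.1),
      (α p.1 - α p.2) =
      ∏ p ∈ Finset.univ.filter (fun p : Fin n × Fin n => p.1 < p.2), (α p.2 - α p.1) :=
    Finset.prod_nbij' Prod.swap Prod.swap (by simp) (by simp) (by simp) (by simp) (by simp)
  rw [hprod, hsplit, Finset.prod_union hdisj, hswap, ← Finset.prod_mul_distrib,
    ← Finset.prod_const, ← Finset.prod_mul_distrib]
  exact Finset.prod_congr rfl fun p _ => by ring

theorem exists_eq_prod_X_sub_C {K : Type*} [Field K] [IsAlgClosed K] {n : ℕ} {f : K[X]}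
    (hf : f.Monic) (hn : f.natDegree = n) :
    ∃ α : Fin n → K, f = ∏ i, (X - C (α i)) := by
  have hs : f.Splits := IsAlgClosed.splits f
  have hcard : f.roots.toList.length = n := by
    rw [Multiset.length_toList, ← hn, hs.natDegree_eq_card_roots]
  subst hcard
  refine ⟨f.roots.toList.get, ?_⟩
  have h := hs.eq_prod_roots_of_monic hf
  conv_lhs => rw [h, ← Multiset.coe_toList f.roots]
  rw [Multiset.map_coe, Multiset.prod_coe, ← List.prod_ofFn]
  congr 1
  conv_lhs => rw [← List.ofFn_get f.roots.toList]
  rw [List.map_ofFn]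
  rfl

theorem exists_coeff_prod_X_sub_C_eq {K : Type*} [Field K] [IsAlgClosed K] {n : ℕ}
    (b : Fin n → K) :
    ∃ α : Fin n → K, ∀ j : Fin n,
      (∏ i, (X - C (α i))).coeff (n - 1 - (j : ℕ)) = b j := by
  have hdeg : (∑ j : Fin n, C (b j) * X ^ (n - 1 - (j : ℕ))).degree < (n : WithBot ℕ) := by
    refine (degree_sum_le _ _).trans_lt ((Finset.sup_lt_iff (WithBot.bot_lt_coe n)).2 ?_)
    intro j _
    refine (degree_C_mul_X_pow_le _ _).trans_lt ?_
    exact Nat.cast_lt.2 (by omega)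
  obtain ⟨α, hα⟩ := exists_eq_prod_X_sub_C (monic_X_pow_add hdeg)
    (natDegree_eq_of_degree_eq_some (by
      rw [degree_add_eq_left_of_degree_lt (by simpa using hdeg), degree_X_pow]))
  refine ⟨α, fun j => ?_⟩
  rw [← hα, coeff_add, coeff_X_pow, if_neg (by omega), zero_add, finsetSum_coeff,
    Finset.sum_eq_single j]
  · simp
  · intro k _ hk
    rw [coeff_C_mul, coeff_X_pow, if_neg, mul_zero]
    exact fun h => hk (Fin.ext (by omega))
  · simp

theorem coeff_prod_X_sub_C_mul {K : Type*} [Field K] {n : ℕ} (α : Fin n → K) {u : K}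
    (hu : u ≠ 0) {k : ℕ} (hk : k ≤ n) :
    (∏ i, (X - C (u * α i))).coeff k = u ^ (n - k) * (∏ i, (X - C (α i))).coeff k := by
  have h : (∏ i, (X - C (u * α i))).comp (C u * X) = C (u ^ n) * ∏ i, (X - C (α i)) := by
    simp [prod_comp, ← mul_sub, Finset.prod_mul_distrib]
  have hc := congrArg (coeff · k) h
  simp only [comp_C_mul_X_coeff, coeff_C_mul] at hc
  apply mul_right_cancel₀ (pow_ne_zero k hu)
  rw [hc, mul_right_comm, ← pow_add, Nat.sub_add_cancel hk]

section Discriminant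

variable {n : ℕ} {E : (Fin n → ℂ) → ℂ}

/-- Weighted homogeneity of the discriminant. -/
theorem disc_weighted_homogeneous
    (hE : ∀ α : Fin n → ℂ, E (fun j => (∏ i, (X - C (α i))).coeff (n - 1 - (j : ℕ))) =
      ∏ p ∈ Finset.univ.filter (fun p : Fin n × Fin n => p.1 < p.2), (α p.1 - α p.2) ^ 2)
    {u : ℂ} (hu : u ≠ 0) (b : Fin n → ℂ) :
    E (fun j : Fin n => u ^ ((j : ℕ) + 1) * b j) = u ^ (n * (n - 1)) * E b := by
  obtain ⟨α, hα⟩ := exists_coeff_prod_X_sub_C_eq b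
  have h1 := hE fun i => u * α i
  have h2 := hE α
  have hb : (fun j : Fin n => (∏ i, (X - C (u * α i))).coeff (n - 1 - (j : ℕ))) =
      fun j : Fin n => u ^ ((j : ℕ) + 1) * b j := by
    funext j
    rw [coeff_prod_X_sub_C_mul α hu (by omega), hα]
    congr 2
    omega
  simp only [hα] at h2
  rw [hb, prod_sq_sub_eq_prod_derivative fun i => u * α i] at h1
  rw [h1, h2, prod_sq_sub_eq_prod_derivative, mul_left_comm]
  congr 1
  simp [← mul_sub, Finset.prod_mul_distrib, ← pow_mul, mul_comm]

/-- The discriminant of `Xⁿ + X` is `±(n - 1)ⁿ⁻¹`. -/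
theorem disc_X_pow_add_X (hn : 3 ≤ n)
    (hE : ∀ α : Fin n → ℂ, E (fun j => (∏ i, (X - C (α i))).coeff (n - 1 - (j : ℕ))) =
      ∏ p ∈ Finset.univ.filter (fun p : Fin n × Fin n => p.1 < p.2), (α p.1 - α p.2) ^ 2) :
    ∃ k : ℕ, E (fun j : Fin n => if (j : ℕ) = n - 2 then (1 : ℂ) else 0) =
      (-1) ^ k * ((n - 1 : ℕ) : ℂ) ^ (n - 1) := by
  have hlt : (X : ℂ[X]).degree < n := by
    rw [degree_X]
    exact_mod_cast (by omega : 1 < n)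
  obtain ⟨α, hα⟩ := exists_eq_prod_X_sub_C (f := X ^ n + X) (monic_X_pow_add hlt)
    (natDegree_eq_of_degree_eq_some (by
      rw [degree_add_eq_left_of_degree_lt (by simpa using hlt), degree_X_pow]))
  have hb : (fun j : Fin n => (∏ i, (X - C (α i))).coeff (n - 1 - (j : ℕ))) =
      fun j : Fin n => if (j : ℕ) = n - 2 then (1 : ℂ) else 0 := by
    funext j
    rw [← hα, coeff_add, coeff_X_pow, if_neg (by omega), zero_add, coeff_X]
    exact if_congr (by omega) rfl rfl
  have hder (i : Fin n) : ∏ j ∈ Finset.univ.erase i, (α i - α j) =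
      n * α i ^ (n - 1) + 1 := by
    have h := Lagrange.eval_nodal_derivative_eval_node_eq (v := α) (Finset.mem_univ i)
    rw [Lagrange.eval_nodal] at h
    rw [← h, Lagrange.nodal, ← hα]
    simp [derivative_X_pow]
  have hroot (i : Fin n) : α i * (α i ^ (n - 1) + 1) = 0 := by
    have h : (X ^ n + X : ℂ[X]).eval (α i) = 0 := by
      rw [hα, eval_prod]
      exact Finset.prod_eq_zero (Finset.mem_univ i) (by simp)
    rw [← h]
    simp only [eval_add, eval_pow, eval_X]
    rw [mul_add, ← pow_succ', Nat.sub_add_cancel (by omega), mul_one]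
  obtain ⟨i₀, hi₀⟩ : ∃ i, α i = 0 := by
    have h : (X ^ n + X : ℂ[X]).eval 0 = 0 := by simp; omega
    rw [hα, eval_prod, Finset.prod_eq_zero_iff] at h
    obtain ⟨i, _, hi⟩ := h
    exact ⟨i, by simpa using hi⟩
  have hne (i : Fin n) (hi : i ≠ i₀) : α i ≠ 0 := by
    intro h
    have h' := hder i₀
    rw [Finset.prod_eq_zero (Finset.mem_erase.2 ⟨hi, Finset.mem_univ i⟩) (by rw [hi₀, h, sub_zero]),
      hi₀, zero_pow (by omega)] at h'
    simp at h'
  have h := hE α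
  rw [hb, prod_sq_sub_eq_prod_derivative, Finset.prod_congr rfl fun i _ => hder i,
    ← Finset.mul_prod_erase _ _ (Finset.mem_univ i₀), hi₀, zero_pow (by omega),
    Finset.prod_congr rfl fun i hi => show (n : ℂ) * α i ^ (n - 1) + 1 = -((n - 1 : ℕ) : ℂ) by
      have h1 := (mul_eq_zero.1 (hroot i)).resolve_left (hne i (Finset.ne_of_mem_erase hi))
      rw [eq_neg_of_add_eq_zero_left h1, Nat.cast_sub (by omega)]
      push_cast
      ring,
    Finset.prod_const, Finset.card_erase_of_mem (Finset.mem_univ _), Finset.card_univ,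
    Fintype.card_fin, neg_pow ((n - 1 : ℕ) : ℂ), mul_zero, zero_add, one_mul, ← mul_assoc, ← pow_add] at h
  exact ⟨_, h⟩

end Discriminant

/-- If `u ^ (n * m) * D (u ^ (-m))` extends to a polynomial in `u` not vanishing at `0`, then
`D` has degree `n` and the value at `0` is its leading coefficient. -/
theorem natDegree_eq_and_leadingCoeff_eq_of_reverse {K : Type*} [Field K] [Infinite K]
    {D P : K[X]} {n m : ℕ} (hm : m ≠ 0) (hP : P.eval 0 ≠ 0)
    (h : ∀ u : K, u ≠ 0 → P.eval u = u ^ (n * m) * D.eval ((u ^ m)⁻¹)) :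
    D.natDegree = n ∧ D.leadingCoeff = P.eval 0 := by
  set R := expand K m D.reverse with hR
  have hR0 : R.coeff 0 = D.leadingCoeff := by
    rw [hR, coeff_zero_eq_eval_zero, expand_eval, zero_pow hm, ← coeff_zero_eq_eval_zero,
      coeff_zero_reverse]
  have hP0 : P.coeff 0 ≠ 0 := by rwa [coeff_zero_eq_eval_zero]
  have hPne : P ≠ 0 := fun h => hP0 (by simp [h])
  have hkey : P * X ^ (D.natDegree * m) = R * X ^ (n * m) := by
    refine eq_of_infinite_eval_eq _ _ ((Set.finite_singleton (0 : K)).infinite_compl.mono ?_)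
    intro u hu
    have hu0 : u ≠ 0 := hu
    have hum : (u ^ m)⁻¹ ≠ 0 := inv_ne_zero (pow_ne_zero m hu0)
    let _ : Invertible (u ^ m)⁻¹ := invertibleOfNonzero hum
    have hrev := eval₂_reverse_mul_pow (RingHom.id K) (u ^ m)⁻¹ D
    rw [invOf_eq_inv, inv_inv, inv_pow, ← pow_mul] at hrev
    change D.reverse.eval (u ^ m) * (u ^ (m * D.natDegree))⁻¹ = D.eval (u ^ m)⁻¹ at hrev
    change (P * X ^ (D.natDegree * m)).eval u = (R * X ^ (n * m)).eval u
    simp only [eval_mul, eval_pow, eval_X, h u hu0, ← hrev, hR, expand_eval]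
    rw [mul_comm m D.natDegree]
    field_simp
  have hRne : R ≠ 0 := by
    intro h0
    rw [h0, zero_mul] at hkey
    exact mul_ne_zero hPne (pow_ne_zero _ X_ne_zero) hkey
  have hD : D ≠ 0 := by
    rintro rfl
    simp [hR] at hRne
  have hRt : R.natTrailingDegree = 0 :=
    natTrailingDegree_eq_zero.2 (Or.inr (by rwa [hR0, leadingCoeff_ne_zero]))
  have hPt : P.natTrailingDegree = 0 := natTrailingDegree_eq_zero.2 (Or.inr hP0)
  have hdeg : D.natDegree = n := by
    have h1 := congrArg natTrailingDegree hkey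
    rw [natTrailingDegree_mul_X_pow hPne, natTrailingDegree_mul_X_pow hRne, hRt, hPt, zero_add,
      zero_add] at h1
    exact Nat.eq_of_mul_eq_mul_right (Nat.pos_of_ne_zero hm) h1
  refine ⟨hdeg, ?_⟩
  rw [hdeg] at hkey
  rw [← hR0, ← coeff_zero_eq_eval_zero, mul_right_cancel₀ (pow_ne_zero _ X_ne_zero) hkey]

theorem eval_aeval_eq_eval_map {σ : Type*} (Δ : MvPolynomial σ ℚ) (g : σ → ℂ[X]) (u : ℂ) :
    (MvPolynomial.aeval g Δ).eval u =
      MvPolynomial.eval (fun j => (g j).eval u) (MvPolynomial.map (algebraMap ℚ ℂ) Δ) := by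
  simp only [MvPolynomial.eval_map, ← MvPolynomial.aeval_def, ← coe_aeval_eq_eval]
  exact MvPolynomial.comp_aeval_apply g ((aeval u).restrictScalars ℚ) Δ

theorem eval_map_aeval_eq_eval_map {σ : Type*} (Δ : MvPolynomial σ ℚ) (g : σ → ℚ[X]) (t : ℂ) :
    ((MvPolynomial.aeval g Δ).map (algebraMap ℚ ℂ)).eval t =
      MvPolynomial.eval (fun j => aeval t (g j)) (MvPolynomial.map (algebraMap ℚ ℂ) Δ) := by
  rw [MvPolynomial.eval_map, ← MvPolynomial.aeval_def, eval_map_algebraMap]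
  exact MvPolynomial.comp_aeval_apply g (aeval t) Δ

/-- On the line where only the coefficient of `X` varies, the discriminant has degree `n` and
leading coefficient `±(n - 1)ⁿ⁻¹`. -/
theorem disc_vertical_line_natDegree_and_leadingCoeff {n : ℕ} (hn : 3 ≤ n)
    (Δ : MvPolynomial (Fin n) ℚ)
    (hΔ : ∀ α : Fin n → ℂ,
      MvPolynomial.eval (fun j : Fin n => (∏ i, (X - C (α i))).coeff (n - 1 - (j : ℕ)))
          (MvPolynomial.map (algebraMap ℚ ℂ) Δ) =
        ∏ p ∈ Finset.univ.filter (fun p : Fin n × Fin n => p.1 < p.2), (α p.1 - α p.2) ^ 2)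
    (a : ℕ → ℚ) (c : ℚ) {D : ℚ[X]}
    (hD : D = MvPolynomial.aeval (fun j : Fin n => if (j : ℕ) < n - 2 then C (a j)
      else if (j : ℕ) = n - 2 then X else C c) Δ) :
    D.natDegree = n ∧ ∃ k : ℕ, D.leadingCoeff = (-1) ^ k * ((n - 1 : ℕ) : ℚ) ^ (n - 1) := by
  set E : (Fin n → ℂ) → ℂ := fun b =>
    MvPolynomial.eval b (MvPolynomial.map (algebraMap ℚ ℂ) Δ)
  obtain ⟨k, hk⟩ := disc_X_pow_add_X (E := E) hn hΔ
  set P : ℂ[X] := MvPolynomial.aeval (fun j : Fin n =>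
    if (j : ℕ) < n - 2 then C (a j : ℂ) * X ^ ((j : ℕ) + 1)
      else if (j : ℕ) = n - 2 then 1 else C (c : ℂ) * X ^ ((j : ℕ) + 1)) Δ with hP
  have hP0 : P.eval 0 = (-1) ^ k * ((n - 1 : ℕ) : ℂ) ^ (n - 1) := by
    rw [hP, eval_aeval_eq_eval_map, ← hk]
    congr 2
    funext j
    split_ifs <;> first | omega | simp
  have hP0' : P.eval 0 ≠ 0 := by
    rw [hP0]
    have : n - 1 ≠ 0 := by omega
    exact mul_ne_zero (by simp) (pow_ne_zero _ (by exact_mod_cast this))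
  obtain ⟨h1, h2⟩ := natDegree_eq_and_leadingCoeff_eq_of_reverse
    (D := D.map (algebraMap ℚ ℂ)) (n := n) (m := n - 1) (by omega) hP0' fun u hu => by
      rw [hD, eval_map_aeval_eq_eval_map]
      refine Eq.trans ?_ (disc_weighted_homogeneous (E := E) hΔ hu _)
      rw [hP, eval_aeval_eq_eval_map]
      congr 2
      funext j
      split_ifs with hj hj'
      · simp only [eval_mul, eval_C, eval_pow, eval_X, aeval_C, eq_ratCast, mul_comm]
      · rw [hj', show n - 2 + 1 = n - 1 by omega]
        simp [hu]
      · simp only [eval_mul, eval_C, eval_pow, eval_X, aeval_C, eq_ratCast, mul_comm]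
  rw [natDegree_map] at h1
  rw [leadingCoeff_map, hP0] at h2
  refine ⟨h1, k, ?_⟩
  apply (algebraMap ℚ ℂ).injective
  rw [h2]
  simp

theorem eq_odd_sq_add_one_of_sq_eq {n k : ℕ} (hn : 3 ≤ n) (heven : Even n) {l : ℚ}
    (hl : l ^ 2 = (-1) ^ k * ((n - 1 : ℕ) : ℚ) ^ (n - 1)) : ∃ m, Odd m ∧ n = m ^ 2 + 1 := by
  obtain ⟨r, hr⟩ : Odd (n - 1) := by
    obtain ⟨s, hs⟩ := heven
    exact ⟨s - 1, by omega⟩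
  have hpos : (0 : ℚ) < ((n - 1 : ℕ) : ℚ) := by exact_mod_cast (by omega : 0 < n - 1)
  have hsign : ((-1 : ℚ)) ^ k = 1 := by
    rcases neg_one_pow_eq_or ℚ k with h | h
    · exact h
    · rw [h] at hl
      have := pow_pos hpos (n - 1)
      nlinarith [sq_nonneg l]
  have hsq : IsSquare ((n - 1 : ℕ) : ℚ) := by
    refine ⟨l / ((n - 1 : ℕ) : ℚ) ^ r, ?_⟩
    have h2 : ((n - 1 : ℕ) : ℚ) ^ (n - 1) =
        ((n - 1 : ℕ) : ℚ) ^ r * ((n - 1 : ℕ) : ℚ) ^ r * ((n - 1 : ℕ) : ℚ) := by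
      rw [← pow_add, ← pow_succ]
      congr 1
      omega
    rw [hsign, one_mul, h2] at hl
    field_simp
    rw [hl]
    ring
  obtain ⟨m, hm⟩ := Rat.isSquare_natCast_iff.1 hsq
  refine ⟨m, ?_, by rw [sq, ← hm]; omega⟩
  have : Odd (m * m) := hm ▸ ⟨r, hr⟩
  exact (Nat.odd_mul.1 this).1

theorem irreducible_X_sq_sub_aeval {D : ℚ[X]} (hD : ¬ IsSquare D) :
    Irreducible ((MvPolynomial.X 0) ^ 2 - aeval (MvPolynomial.X 1) D : MvPolynomial (Fin 2) ℚ) := by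
  rw [← MulEquiv.irreducible_iff (MvPolynomial.finSuccEquiv ℚ 1)]
  set d : MvPolynomial (Fin 1) ℚ := aeval (MvPolynomial.X 0) D with hd
  have himage : MvPolynomial.finSuccEquiv ℚ 1
      ((MvPolynomial.X 0) ^ 2 - aeval (MvPolynomial.X 1) D) = X ^ 2 - C d := by
    rw [map_sub, map_pow, MvPolynomial.finSuccEquiv_X_zero, ← aeval_algHom_apply,
      show (1 : Fin 2) = Fin.succ 0 from rfl, MvPolynomial.finSuccEquiv_X_succ, hd]
    congr 1
    exact aeval_algebraMap_apply (MvPolynomial (Fin 1) ℚ)[X] (MvPolynomial.X (0 : Fin 1)) D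
  rw [himage, (monic_X_pow_sub_C d two_ne_zero).irreducible_iff_roots_eq_zero_of_degree_le_three
    natDegree_X_pow_sub_C.ge (natDegree_X_pow_sub_C.trans_le (by norm_num))]
  refine Multiset.eq_zero_of_forall_notMem fun r hr => hD ?_
  have hr' : r ^ 2 = d := by
    simpa [sub_eq_zero] using isRoot_of_mem_roots hr
  refine ⟨MvPolynomial.aeval (fun _ => X) r, ?_⟩
  rw [← map_mul, ← sq, hr', hd, ← aeval_algHom_apply]
  simp

/-- (Dietmann.) Let `n ≥ 3` with `n` not an odd square plus one, let
`a₁,…,a_{n−2} ∈ ℤ` and `c ∈ ℚ`. Then `z² − Δ(a₁,…,a_{n−2}, a_{n−1}, c)` is irreducible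
as a polynomial in the two variables `z = X 0` and `a_{n−1} = X 1` over `ℚ`. Here `Δ`
is the discriminant of `xⁿ + a₁xⁿ⁻¹ + ⋯ + aₙ` as a polynomial in the coefficients,
characterized by the property that it evaluates to `Π_{i<j} (αᵢ − αⱼ)²` on the
coefficients of `Π (x − αᵢ)`. -/
theorem disc_slice_irreducible_vertical_line (n : ℕ) (hn : 3 ≤ n)
    (hshape : ∀ m : ℕ, Odd m → n ≠ m ^ 2 + 1)
    (Δ : MvPolynomial (Fin n) ℚ)
    (hΔ : ∀ α : Fin n → ℂ,
      MvPolynomial.eval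
          (fun j : Fin n =>
            (∏ i : Fin n, (Polynomial.X - Polynomial.C (α i))).coeff (n - 1 - (j : ℕ)))
          (MvPolynomial.map (algebraMap ℚ ℂ) Δ) =
        ∏ p ∈ Finset.univ.filter (fun p : Fin n × Fin n => p.1 < p.2),
          (α p.1 - α p.2) ^ 2)
    (a : ℕ → ℤ) (c : ℚ) :
    Irreducible
      ((MvPolynomial.X 0) ^ 2 -
        MvPolynomial.aeval
          (fun j : Fin n =>
            if (j : ℕ) < n - 2 then MvPolynomial.C ((a ((j : ℕ) + 1) : ℚ))
            else if (j : ℕ) = n - 2 then MvPolynomial.X 1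
            else MvPolynomial.C c) Δ :
        MvPolynomial (Fin 2) ℚ) := by
  set D : ℚ[X] := MvPolynomial.aeval (fun j : Fin n => if (j : ℕ) < n - 2
    then C ((a ((j : ℕ) + 1) : ℚ)) else if (j : ℕ) = n - 2 then X else C c) Δ with hD
  have haeval : MvPolynomial.aeval
      (fun j : Fin n =>
        if (j : ℕ) < n - 2 then MvPolynomial.C ((a ((j : ℕ) + 1) : ℚ))
        else if (j : ℕ) = n - 2 then MvPolynomial.X 1
        else MvPolynomial.C c) Δ = aeval (MvPolynomial.X 1 : MvPolynomial (Fin 2) ℚ) D := by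
    rw [hD, MvPolynomial.comp_aeval_apply]
    congr 2
    funext j
    split_ifs
    · exact (aeval_C _ _).symm
    · exact (aeval_X _).symm
    · exact (aeval_C _ _).symm
  rw [haeval]
  refine irreducible_X_sq_sub_aeval ?_
  rintro ⟨q, hq⟩
  obtain ⟨hdeg, k, hlead⟩ := disc_vertical_line_natDegree_and_leadingCoeff hn Δ hΔ
    (fun j => (a (j + 1) : ℚ)) c hD
  rw [hq, leadingCoeff_mul, ← sq] at hlead
  rw [hq, ← sq, natDegree_pow, two_mul] at hdeg
  obtain ⟨m, hm, hnm⟩ := eq_odd_sq_add_one_of_sq_eq hn ⟨_, hdeg.symm⟩ hlead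
  exact hshape m hm hnm
end

section
/- Let n ≥ 2 and let G be a primitive transitive subgroup of S_n. Then for every ε > 0 there is a constant c(n,ε) such that for all X ≥ 2, F_n(X;G) ≤ c(n,ε) · X^{B+ε}, where B = (n+2)/4 − 1 + 1/ind(G), ind(G) = min{ ind(g) : g ∈ G, g ≠ 1 }, and for g ∈ S_n, ind(g) = n minus the number of orbits of the cyclic group generated by g on {1,2,…,n}. -/
open Polynomial

noncomputable section

/-- A fixed algebraic closure of `ℚ`. -/
abbrev Qbar : Type := AlgebraicClosure ℚ

/-- The discriminant of a subfield of `ℚ̄` (zero if it is not a number field). -/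
def fieldDiscr (K : IntermediateField ℚ Qbar) : ℤ := by
  by_cases h : FiniteDimensional ℚ K
  · exact @NumberField.discr K _ ⟨⟩
  · exact 0

/-- The action of `Gal(ℚ̄/ℚ)` on the embeddings of `K` into `ℚ̄`; its image is the
Galois group of the Galois closure of `K`, acting on the embeddings of `K`. -/
def galAct (K : IntermediateField ℚ Qbar) :
    (Qbar ≃ₐ[ℚ] Qbar) →* Equiv.Perm (K →ₐ[ℚ] Qbar) where
  toFun σ :=
    { toFun := fun ι => σ.toAlgHom.comp ι
      invFun := fun ι => σ.symm.toAlgHom.comp ι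
      left_inv := fun ι => by ext x; simp
      right_inv := fun ι => by ext x; simp }
  map_one' := by
    apply Equiv.ext; intro ι; ext x; simp
  map_mul' := fun σ τ => by
    apply Equiv.ext; intro ι; ext x; simp

/-- `K` has Galois group (of its Galois closure, acting on the `n` embeddings of `K` in `ℚ̄`)
equal to `G`, up to conjugacy; this is encoded by an identification of the embeddings
with `Fin n` under which the image of the Galois action is exactly `G`. -/
def HasGalGroup (n : ℕ) (K : IntermediateField ℚ Qbar)
    (G : Subgroup (Equiv.Perm (Fin n))) : Prop :=
  ∃ e : (K →ₐ[ℚ] Qbar) ≃ Fin n, ∀ σ : Equiv.Perm (Fin n),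
    σ ∈ G ↔ ∃ g : Qbar ≃ₐ[ℚ] Qbar, Equiv.permCongr e (galAct K g) = σ

/-- The number of number fields of degree `n`, absolute discriminant at most `X`,
and Galois group (as a permutation group on the embeddings) conjugate to `G`. -/
def FnG (n : ℕ) (X : ℝ) (G : Subgroup (Equiv.Perm (Fin n))) : ℕ :=
  Nat.card {K : IntermediateField ℚ Qbar //
    Module.finrank ℚ K = n ∧ |(fieldDiscr K : ℝ)| ≤ X ∧ HasGalGroup n K G}

/-- The number of number fields of degree `n` and absolute discriminant at most `X`. -/
def FnAll (n : ℕ) (X : ℝ) : ℕ :=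
  Nat.card {K : IntermediateField ℚ Qbar //
    Module.finrank ℚ K = n ∧ |(fieldDiscr K : ℝ)| ≤ X}

/-- A subgroup of the permutations of `β` is transitive. -/
def IsTransitiveSub {β : Type*} (G : Subgroup (Equiv.Perm β)) : Prop :=
  ∀ x y : β, ∃ σ ∈ G, σ x = y

/-- `G` admits a nontrivial block system: a partition of `β` into `k ≥ 2` nonempty parts,
some part having at least two elements, whose parts are permuted by every element of `G`. -/
def HasBlockSystem {β : Type*} (G : Subgroup (Equiv.Perm β)) : Prop :=
  ∃ (k : ℕ) (R : Fin k → Set β), 2 ≤ k ∧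
    (∀ j, (R j).Nonempty) ∧
    (∃ j, 2 ≤ Nat.card (R j)) ∧
    (∀ x : β, ∃! j, x ∈ R j) ∧
    (∀ σ ∈ G, ∀ i, ∃ j, (fun x => σ x) '' R i = R j)

/-- An imprimitive permutation group: transitive with a nontrivial block system. -/
def IsImprimitiveSub {β : Type*} (G : Subgroup (Equiv.Perm β)) : Prop :=
  IsTransitiveSub G ∧ HasBlockSystem G

/-- A primitive permutation group: transitive with no nontrivial block system. -/
def IsPrimitiveSub {β : Type*} (G : Subgroup (Equiv.Perm β)) : Prop :=
  IsTransitiveSub G ∧ ¬ HasBlockSystem G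

end

/-- The number of orbits of the cyclic group generated by `g` on `Fin n`. -/
noncomputable def permOrbitCount {n : ℕ} (g : Equiv.Perm (Fin n)) : ℕ :=
  Nat.card {s : Set (Fin n) // ∃ x : Fin n, s = {y | ∃ k : ℤ, (g ^ k) x = y}}

/-- `ind(g) = n` minus the number of orbits of `⟨g⟩` on `{1, …, n}`. -/
noncomputable def permInd {n : ℕ} (g : Equiv.Perm (Fin n)) : ℕ :=
  n - permOrbitCount g

/-- `ind(G) = min { ind(g) : 1 ≠ g ∈ G }`. -/
noncomputable def grpInd {n : ℕ} (G : Subgroup (Equiv.Perm (Fin n))) : ℕ :=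
  sInf {m : ℕ | ∃ g ∈ G, g ≠ 1 ∧ m = permInd g}

/-- The exponent `M` with `x_j ^ M` in any ideal containing the first `r` power sums. -/
def powerSumExponent : ℕ → ℕ
  | 0 => 0
  | r + 1 => 1 + r * powerSumExponent r

theorem pow_mem_of_weighted_powerSums_mem {R ι : Type*} [CommRing R] [DecidableEq ι] (r : ℕ) :
    ∀ (I : Ideal R) (s : Finset ι) (m x : ι → R), s.card = r →
      (∀ t ⊆ s, t.Nonempty → IsUnit (∑ j ∈ t, m j)) →
      (∀ i, 1 ≤ i → i ≤ r → ∑ j ∈ s, m j * x j ^ i ∈ I) →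
      ∀ j ∈ s, x j ^ powerSumExponent r ∈ I := by
  induction r with
  | zero =>
    intro I s m x hs _ _ j hj
    simp_all
  | succ r ih =>
    intro I s m x hs hm hw a ha
    have hcard : (s.erase a).card = r := by rw [Finset.card_erase_of_mem ha, hs]; rfl
    have key : x a * ∏ i ∈ s.erase a, (x a - x i) ∈ I := by
      set g : Polynomial R := ∏ i ∈ s.erase a, (Polynomial.X - Polynomial.C (x i)) with hg
      have hdeg : g.natDegree ≤ r := by
        refine (Polynomial.natDegree_prod_le _ _).trans ?_
        refine (Finset.sum_le_card_nsmul _ _ 1 fun i _ => Polynomial.natDegree_X_sub_C_le _).trans ?_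
        simp [hcard]
      have hsum : ∑ j ∈ s, m j * x j * g.eval (x j) ∈ I := by
        have : ∑ j ∈ s, m j * x j * g.eval (x j)
            = ∑ l ∈ Finset.range (r + 1), g.coeff l * ∑ j ∈ s, m j * x j ^ (l + 1) := by
          simp_rw [Polynomial.eval_eq_sum_range' (Nat.lt_succ_of_le hdeg), Finset.mul_sum]
          rw [Finset.sum_comm]
          refine Finset.sum_congr rfl fun l _ => Finset.sum_congr rfl fun j _ => by ring
        rw [this]
        refine Ideal.sum_mem _ fun l hl => I.mul_mem_left _ (hw _ (by omega) ?_)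
        have := Finset.mem_range.1 hl
        omega
      rw [Finset.sum_eq_single_of_mem a ha] at hsum
      · have hu : IsUnit (m a) := by simpa using hm {a} (by simpa using ha) (by simp)
        rw [mul_assoc, Ideal.unit_mul_mem_iff_mem I hu] at hsum
        simpa [hg, Polynomial.eval_prod] using hsum
      · intro b hb hba
        have : g.eval (x b) = 0 := by
          rw [hg, Polynomial.eval_prod]
          exact Finset.prod_eq_zero (Finset.mem_erase.2 ⟨hba, hb⟩) (by simp)
        rw [this, mul_zero]
    have merge : ∀ i ∈ s.erase a, x a ^ powerSumExponent r ∈ I ⊔ Ideal.span {x a - x i} := by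
      intro i hi
      obtain ⟨hia, his⟩ := Finset.mem_erase.1 hi
      set J := I ⊔ Ideal.span {x a - x i}
      have hd : x a - x i ∈ J := Ideal.mem_sup_right (Ideal.mem_span_singleton_self _)
      have ha' : a ∈ s.erase i := Finset.mem_erase.2 ⟨hia.symm, ha⟩
      refine ih J (s.erase i) (Function.update m a (m a + m i)) x
        (by rw [Finset.card_erase_of_mem his, hs]; rfl) ?_ ?_ a ha'
      · intro t ht hne
        by_cases hat : a ∈ t
        · have hit : i ∉ t := fun h => by simpa using ht h
          have := hm (insert i t) (by
            intro z hz
            rcases Finset.mem_insert.1 hz with rfl | hz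
            · exact his
            · exact Finset.mem_of_mem_erase (ht hz)) (by simp)
          rw [Finset.sum_insert hit] at this
          convert this using 1
          rw [← Finset.add_sum_erase t _ hat, ← Finset.add_sum_erase t m hat,
            Function.update_self, Finset.sum_congr rfl
              (fun z hz => Function.update_of_ne (Finset.ne_of_mem_erase hz) _ _)]
          ring
        · rw [Finset.sum_congr rfl
            (fun z hz => Function.update_of_ne (ne_of_mem_of_not_mem hz hat) _ _)]
          exact hm t (ht.trans (Finset.erase_subset _ _)) hne
      · intro l h1 hl
        have h2 := (le_sup_left : I ≤ J) (hw l h1 (by omega))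
        have h3 : x a ^ l - x i ^ l ∈ J := by
          obtain ⟨c, hc⟩ := sub_dvd_pow_sub_pow (x a) (x i) l
          rw [hc]
          exact J.mul_mem_right _ hd
        have h4 := J.add_mem h2 (J.mul_mem_left (m i) h3)
        convert h4 using 1
        rw [← Finset.add_sum_erase _ _ ha', ← Finset.add_sum_erase s _ his,
          ← Finset.add_sum_erase (s.erase i) _ ha', Function.update_self, Finset.sum_congr rfl
              (fun z hz => by rw [Function.update_of_ne (Finset.ne_of_mem_erase hz)])]
        ring
    have hdvd : ∀ i ∈ s.erase a, Ideal.Quotient.mk I (x a - x i) ∣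
        Ideal.Quotient.mk I (x a ^ powerSumExponent r) := by
      intro i hi
      obtain ⟨u, hu, v, hv, huv⟩ := Submodule.mem_sup.1 (merge i hi)
      obtain ⟨c, rfl⟩ := Ideal.mem_span_singleton.1 hv
      refine ⟨Ideal.Quotient.mk I c, ?_⟩
      rw [← huv, map_add, Ideal.Quotient.eq_zero_iff_mem.2 hu, zero_add, map_mul]
    have := mul_dvd_mul_left (Ideal.Quotient.mk I (x a)) (Finset.prod_dvd_prod_of_dvd _ _ hdvd)
    rw [← map_prod, ← map_mul, Ideal.Quotient.eq_zero_iff_mem.2 key, zero_dvd_iff,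
      Finset.prod_const, hcard, ← map_pow, ← map_mul, Ideal.Quotient.eq_zero_iff_mem] at this
    convert this using 1
    rw [← pow_mul, ← pow_succ', powerSumExponent]
    congr 1
    ring

open Polynomial in
/-- The filtered version of `pow_mem_of_weighted_powerSums_mem`: if the weighted power sums of
`θ` are constants, then a fixed power of `θ j` is a polynomial of smaller degree in `θ`. -/
theorem pow_mem_span_pow_of_weighted_powerSums {k A : Type*} [Field k] [CommRing A] [Algebra k A]
    (r : ℕ) (m : Fin r → k) (θ : Fin r → A) (s : ℕ → k)
    (hm : ∀ t : Finset (Fin r), t.Nonempty → ∑ j ∈ t, m j ≠ 0)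
    (hs : ∀ i, 1 ≤ i → i ≤ r → ∑ j, algebraMap k A (m j) * θ j ^ i = algebraMap k A (s i))
    (j : Fin r) :
    θ j ^ powerSumExponent r ∈
      (Submodule.span k (insert 1 (Set.range θ))) ^ (powerSumExponent r - 1) := by
  set U := Submodule.span k (insert 1 (Set.range θ)) with hU
  set B : Subalgebra k A[X] := Algebra.adjoin k (insert X (Set.range fun j => C (θ j) * X)) with hB
  have hX : X ∈ B := Algebra.subset_adjoin (Set.mem_insert _ _)
  have hθ : ∀ j, C (θ j) * X ∈ B := fun j =>
    Algebra.subset_adjoin (Set.mem_insert_of_mem _ ⟨j, rfl⟩)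
  have hcoeff : ∀ b ∈ B, ∀ d, b.coeff d ∈ U ^ d := by
    intro b hb
    induction hb using Algebra.adjoin_induction with
    | mem x hx =>
      intro d
      rcases hx with rfl | ⟨j, rfl⟩
      · rw [coeff_X]
        split_ifs with h
        · subst h
          rw [pow_one]
          exact Submodule.subset_span (Set.mem_insert _ _)
        · exact Submodule.zero_mem _
      · simp only [coeff_C_mul, coeff_X]
        split_ifs with h
        · subst h
          rw [pow_one, mul_one]
          exact Submodule.subset_span (Set.mem_insert_of_mem _ ⟨j, rfl⟩)
        · simp
    | algebraMap c =>
      intro d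
      rw [Polynomial.algebraMap_apply, coeff_C]
      split_ifs with h
      · subst h
        rw [pow_zero]
        exact Submodule.algebraMap_mem c
      · exact Submodule.zero_mem _
    | add x y _ _ hx hy =>
      intro d
      rw [coeff_add]
      exact Submodule.add_mem _ (hx d) (hy d)
    | mul x y _ _ hx hy =>
      intro d
      rw [coeff_mul]
      refine Submodule.sum_mem _ fun p hp => ?_
      rw [← Finset.HasAntidiagonal.mem_antidiagonal.1 hp, pow_add]
      exact Submodule.mul_mem_mul (hx _) (hy _)
  set Xb : B := ⟨X, hX⟩
  have hmem := pow_mem_of_weighted_powerSums_mem r (Ideal.span {Xb}) Finset.univ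
    (fun j => algebraMap k B (m j)) (fun j => (⟨C (θ j) * X, hθ j⟩ : B)) (by simp)
    (fun t _ ht => by
      rw [← map_sum]
      exact (IsUnit.mk0 _ (hm t ht)).map _)
    (fun i h1 h2 => by
      rw [Ideal.mem_span_singleton]
      refine ⟨algebraMap k B (s i) * Xb ^ (i - 1), ?_⟩
      apply Subtype.ext
      have h := congrArg (fun z => C z * X ^ i) (hs i h1 h2)
      obtain ⟨l, rfl⟩ := Nat.exists_eq_add_of_le h1
      simp only [map_sum, map_mul, map_pow, Finset.sum_mul] at h
      simp only [AddSubmonoidClass.coe_finsetSum, MulMemClass.coe_mul, SubmonoidClass.coe_pow,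
        Subalgebra.coe_algebraMap, Polynomial.algebraMap_apply, mul_pow]
      rw [Nat.add_sub_cancel_left]
      calc _ = _ := Finset.sum_congr rfl fun j _ => by ring
        _ = _ := h
        _ = _ := by simp only [Xb]; ring) j (Finset.mem_univ j)
  obtain ⟨b, hb⟩ := Ideal.mem_span_singleton.1 hmem
  have hb' := congrArg (fun z : B => (z : A[X])) hb
  simp only [SubmonoidClass.coe_pow, MulMemClass.coe_mul, Xb] at hb'
  cases hM : powerSumExponent r with
  | zero =>
    simp only [pow_zero]
    exact Submodule.one_le.1 le_rfl
  | succ M =>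
    have := hcoeff b b.2 M
    rw [Nat.add_sub_cancel]
    convert this using 1
    have h2 := congrArg (fun z => z.coeff (M + 1)) hb'
    rw [hM, mul_pow, ← C_pow, coeff_C_mul, coeff_X_pow, if_pos rfl, mul_one, coeff_X_mul] at h2
    exact h2

theorem span_pow_le_of_pow_mem {k A : Type*} [Field k] [CommRing A] [Algebra k A]
    (r M : ℕ) (hM : 0 < r → 0 < M) (θ : Fin r → A)
    (h : ∀ j, θ j ^ M ∈ (Submodule.span k (insert 1 (Set.range θ))) ^ (M - 1)) (d : ℕ) :
    (Submodule.span k (insert 1 (Set.range θ))) ^ d ≤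
      (Submodule.span k (insert 1 (Set.range θ))) ^ (r * M) := by
  set U := Submodule.span k (insert 1 (Set.range θ)) with hU
  have h1U : (1 : A) ∈ U := Submodule.subset_span (Set.mem_insert _ _)
  have hmono : ∀ a b, a ≤ b → U ^ a ≤ U ^ b := fun a b hab =>
    pow_le_pow_right' (Submodule.one_le.2 h1U) hab
  rcases le_or_gt d (r * M) with hd | hd
  · exact hmono _ _ hd
  suffices H : ∀ e, r * M ≤ e → U ^ (e + 1) ≤ U ^ e by
    obtain ⟨c, rfl⟩ := Nat.exists_eq_add_of_le hd.le
    clear hd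
    induction c with
    | zero => simp
    | succ c ih => exact (H _ (Nat.le_add_right _ _)).trans ih
  intro e he
  conv_lhs => rw [hU, Submodule.span_pow]
  rw [Submodule.span_le]
  intro z hz
  obtain ⟨f, hf⟩ := Set.mem_pow.1 hz
  rw [List.prod_ofFn] at hf
  subst hf
  have hfU : ∀ t : Finset (Fin (e + 1)), ∏ i ∈ t, (f i : A) ∈ U ^ t.card := by
    intro t
    induction t using Finset.induction_on with
    | empty => simpa [-Submodule.mem_one] using Submodule.one_le.1 le_rfl
    | insert a t hat ih =>
      rw [Finset.prod_insert hat, Finset.card_insert_of_notMem hat, pow_succ']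
      exact Submodule.mul_mem_mul (Submodule.subset_span (f a).2) ih
  by_cases hone : ∃ i, (f i : A) = 1
  · obtain ⟨i, hi⟩ := hone
    have := hfU (Finset.univ.erase i)
    rw [Finset.card_erase_of_mem (Finset.mem_univ _), Finset.card_univ, Fintype.card_fin,
      Nat.add_sub_cancel] at this
    rwa [← Finset.mul_prod_erase _ _ (Finset.mem_univ i), hi, one_mul]
  · push Not at hone
    have hj : ∀ i, ∃ j, θ j = f i := fun i => (f i).2.resolve_left (hone i)
    choose g hg using hj
    obtain ⟨j, -, hj⟩ := Finset.exists_lt_card_fiber_of_mul_lt_card_of_maps_to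
      (s := (Finset.univ : Finset (Fin (e + 1)))) (t := (Finset.univ : Finset (Fin r))) (f := g)
      (n := M) (fun _ _ => Finset.mem_univ _) (by simp; omega)
    obtain ⟨t, ht, htM⟩ := Finset.exists_subset_card_eq hj.le
    rw [← Finset.prod_sdiff (Finset.subset_univ t)]
    have h1 := hfU (Finset.univ \ t)
    have h2 : ∏ i ∈ t, (f i : A) = θ j ^ M := by
      rw [← htM]
      refine Finset.prod_eq_pow_card fun i hi => ?_
      rw [← hg i, (Finset.mem_filter.1 (ht hi)).2]
    rw [h2]
    have h3 := Submodule.mul_mem_mul h1 (h j)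
    rw [← pow_add, Finset.card_sdiff_of_subset (Finset.subset_univ t), htM] at h3
    refine hmono _ _ ?_ h3
    simp only [Finset.card_univ, Fintype.card_fin]
    have : t.card ≤ e + 1 := by simpa using Finset.card_le_univ t
    have := hM j.pos
    omega

open scoped Pointwise in
theorem card_le_of_weighted_powerSums {k : Type*} [Field k] (r : ℕ) (m : Fin r → k)
    (s : ℕ → k) (hm : ∀ t : Finset (Fin r), t.Nonempty → ∑ j ∈ t, m j ≠ 0)
    (V : Finset (Fin r → k))
    (hV : ∀ v ∈ V, ∀ i, 1 ≤ i → i ≤ r → ∑ j, m j * v j ^ i = s i) :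
    V.card ≤ (r + 1) ^ (r * powerSumExponent r) := by
  classical
  let θ : Fin r → (V → k) := fun j v => v.1 j
  set U := Submodule.span k (insert 1 (Set.range θ)) with hU
  have h1U : (1 : V → k) ∈ U := Submodule.subset_span (Set.mem_insert _ _)
  have hpow := pow_mem_span_pow_of_weighted_powerSums r m θ s hm (fun i h1 h2 => by
    funext v
    simpa [θ] using hV v.1 v.2 i h1 h2)
  have hle := span_pow_le_of_pow_mem r (powerSumExponent r) (fun hr => by
    obtain ⟨q, rfl⟩ := Nat.exists_eq_succ_of_ne_zero hr.ne'
    rw [powerSumExponent]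
    omega) θ hpow
  have htop : U ^ (r * powerSumExponent r) = ⊤ := by
    rw [eq_top_iff, ← (Pi.basisFun k V).span_eq, Submodule.span_le]
    rintro _ ⟨v, rfl⟩
    have hsep : ∀ w : V, w ≠ v → ∃ u ∈ U, u w = 0 ∧ u v = 1 := by
      intro w hw
      obtain ⟨j, hj⟩ : ∃ j, w.1 j ≠ v.1 j := by
        by_contra! h
        exact hw (Subtype.ext (funext h))
      refine ⟨(v.1 j - w.1 j)⁻¹ • (θ j - w.1 j • 1), U.smul_mem _ (U.sub_mem
        (show θ j ∈ U from Submodule.subset_span (Set.mem_insert_of_mem _ (Set.mem_range_self j))) (U.smul_mem _ h1U)), ?_, ?_⟩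
      · simp [θ]
      · have : v.1 j - w.1 j ≠ 0 := sub_ne_zero.2 hj.symm
        simp [θ, this]
    choose! u hu hu0 hu1 using hsep
    have hprod : ∀ t : Finset V, v ∉ t → ∏ w ∈ t, u w ∈ U ^ t.card := by
      intro t
      induction t using Finset.induction_on with
      | empty => intro _; simpa [-Submodule.mem_one] using Submodule.one_le.1 le_rfl
      | insert a t hat ih =>
        intro hv
        rw [Finset.prod_insert hat, Finset.card_insert_of_notMem hat, pow_succ']
        exact Submodule.mul_mem_mul (hu a (fun h => hv (by simp [h])))
          (ih fun h => hv (Finset.mem_insert_of_mem h))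
    refine hle (Finset.univ.erase v).card ?_
    convert hprod (Finset.univ.erase v) (by simp) using 1
    funext w
    rw [Pi.basisFun_apply, Finset.prod_apply]
    by_cases hw : w = v
    · subst hw
      rw [Pi.single_eq_same, Finset.prod_eq_one]
      intro z hz
      exact hu1 z (Finset.ne_of_mem_erase hz)
    · rw [Pi.single_eq_of_ne hw, eq_comm]
      exact Finset.prod_eq_zero (Finset.mem_erase.2 ⟨hw, Finset.mem_univ w⟩) (hu0 w hw)
  let S : Finset (V → k) := insert 1 (Finset.univ.image θ)
  have hS : (S : Set (V → k)) = insert 1 (Set.range θ) := by simp [S]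
  have hScard : S.card ≤ r + 1 := by
    refine (Finset.card_insert_le _ _).trans ?_
    have := Finset.card_image_le (s := Finset.univ) (f := θ)
    simpa using this
  rw [hU, ← hS, Submodule.span_pow, ← Finset.coe_pow] at htop
  have h1 := finrank_span_finset_le_card (R := k) (S ^ (r * powerSumExponent r))
  rw [Set.finrank, htop, finrank_top, Module.finrank_fintype_fun_eq_card, Fintype.card_coe] at h1
  exact h1.trans (Finset.card_pow_le.trans (Nat.pow_le_pow_left hScard _))

/-- A bound, uniform in `p > n` and `r`, for the number of `n`-tuples of power sums in characteristic
`p` of `n` elements taking at most `r` distinct values, once the first `r` of them are given. -/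
def residueBound (n : ℕ) : ℕ :=
  ∑ r ∈ Finset.range (n + 1), r ^ n * (r + 1) ^ (r * powerSumExponent r)

/-- `t` is the tuple of the first `n` power sums of `n` elements of a field extension of `𝔽_p`
taking at most `r` distinct values. -/
def IsPowerSumTuple (p : ℕ) [Fact p.Prime] (n r : ℕ) (t : Fin n → ZMod p) : Prop :=
  ∃ θ : Fin n → AlgebraicClosure (ZMod p), (Set.range θ).ncard ≤ r ∧
    ∀ i, algebraMap (ZMod p) (AlgebraicClosure (ZMod p)) (t i) = ∑ j, θ j ^ (i.1 + 1)

theorem card_isPowerSumTuple_le (p : ℕ) [Fact p.Prime] (n r : ℕ) (hp : n < p)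
    (c : Fin n → ZMod p) (T : Finset (Fin n → ZMod p))
    (hT : ∀ t ∈ T, IsPowerSumTuple p n r t) (hc : ∀ t ∈ T, ∀ i : Fin n, i.1 < r → t i = c i) :
    T.card ≤ residueBound n := by
  classical
  let k := AlgebraicClosure (ZMod p)
  have fact : ∀ t ∈ T, ∃ r' ≤ n, r' ≤ r ∧ ∃ π : Fin n → Fin r', Function.Surjective π ∧
      ∃ η : Fin r' → k, ∀ i : Fin n, algebraMap (ZMod p) k (t i) = ∑ j, η (π j) ^ (i.1 + 1) := by
    intro t ht
    obtain ⟨θ, h1, h2⟩ := hT t ht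
    have hfin := Set.toFinite (Set.range θ)
    let e := (Finite.equivFin (Set.range θ))
    refine ⟨Nat.card (Set.range θ), ?_, h1, fun i => e ⟨θ i, i, rfl⟩, ?_, fun j => (e.symm j).1, ?_⟩
    · simpa using Finite.card_range_le θ
    · intro j
      obtain ⟨⟨_, i, rfl⟩, hi⟩ := e.surjective j
      exact ⟨i, hi⟩
    · intro i
      simp only [Equiv.symm_apply_apply]
      exact h2 i
  let P : (r' : ℕ) → (Fin n → Fin r') → (Fin n → ZMod p) → Prop := fun r' π t =>
    r' ≤ r ∧ Function.Surjective π ∧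
      ∃ η : Fin r' → k, ∀ i : Fin n, algebraMap (ZMod p) k (t i) = ∑ j, η (π j) ^ (i.1 + 1)
  have hsub : T ⊆ (Finset.range (n + 1)).biUnion fun r' =>
      (Finset.univ : Finset (Fin n → Fin r')).biUnion fun π => T.filter (P r' π) := by
    intro t ht
    obtain ⟨r', hn, hr, π, hπ, η, hη⟩ := fact t ht
    simp only [Finset.mem_biUnion, Finset.mem_range, Finset.mem_univ, true_and, Finset.mem_filter]
    exact ⟨r', by omega, π, ht, hr, hπ, η, hη⟩
  refine (Finset.card_le_card hsub).trans (Finset.card_biUnion_le.trans (Finset.sum_le_sum ?_))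
  intro r' hr'n
  rw [Finset.mem_range] at hr'n
  refine (Finset.card_biUnion_le_card_mul _ _ ((r' + 1) ^ (r' * powerSumExponent r')) ?_).trans ?_
  swap
  · simp
  intro π _
  by_cases hr : r' ≤ r ∧ Function.Surjective π
  swap
  · rw [Finset.filter_false_of_mem fun t _ h => hr ⟨h.1, h.2.1⟩]
    simp
  obtain ⟨hr, hπ⟩ := hr
  have hη : ∀ t : Fin n → ZMod p, ∃ η : Fin r' → k, t ∈ T.filter (P r' π) →
      ∀ i : Fin n, algebraMap (ZMod p) k (t i) = ∑ j, η (π j) ^ (i.1 + 1) := by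
    intro t
    by_cases ht : t ∈ T.filter (P r' π)
    · obtain ⟨η, h⟩ := (Finset.mem_filter.1 ht).2.2.2
      exact ⟨η, fun _ => h⟩
    · exact ⟨0, fun h => absurd h ht⟩
  choose η hη using hη
  have hinj : Set.InjOn η (T.filter (P r' π)) := by
    intro t ht u hu htu
    funext i
    apply (algebraMap (ZMod p) k).injective
    rw [hη t ht i, hη u hu i, htu]
  rw [← Finset.card_image_of_injOn hinj]
  have hfiber : ∀ (v : Fin r' → k) (i : ℕ), ∑ j, v (π j) ^ i =
      ∑ j, (((Finset.univ.filter fun l => π l = j).card : ℕ) : k) * v j ^ i := by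
    intro v i
    rw [← Finset.sum_fiberwise Finset.univ π]
    refine Finset.sum_congr rfl fun j _ => ?_
    rw [← nsmul_eq_mul]
    exact Finset.sum_eq_card_nsmul fun l hl => by rw [(Finset.mem_filter.1 hl).2]
  refine card_le_of_weighted_powerSums r'
    (fun j => (((Finset.univ.filter fun l => π l = j).card : ℕ) : k))
    (fun i => if h : i - 1 < n then algebraMap (ZMod p) k (c ⟨i - 1, h⟩) else 0) ?_ _ ?_
  · intro t ⟨j, hj⟩ h0
    rw [← Nat.cast_sum, CharP.cast_eq_zero_iff k p] at h0
    have h1 : ∑ j ∈ t, (Finset.univ.filter fun l => π l = j).card ≤ n := by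
      calc _ ≤ ∑ j, (Finset.univ.filter fun l => π l = j).card :=
            Finset.sum_le_sum_of_subset (Finset.subset_univ t)
        _ = (Finset.univ : Finset (Fin n)).card :=
            (Finset.card_eq_sum_card_fiberwise fun _ _ => Finset.mem_univ _).symm
        _ = n := by simp
    have h2 : 0 < ∑ j ∈ t, (Finset.univ.filter fun l => π l = j).card := by
      refine Finset.sum_pos' (fun _ _ => Nat.zero_le _) ⟨j, hj, ?_⟩
      obtain ⟨l, hl⟩ := hπ j
      exact Finset.card_pos.2 ⟨l, by simp [hl]⟩
    exact absurd (Nat.le_of_dvd h2 h0) (by omega)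
  · intro v hv i h1 h2
    obtain ⟨t, ht, rfl⟩ := Finset.mem_image.1 hv
    have hi : i - 1 < n := by omega
    rw [dif_pos hi, ← hfiber, ← hc t (Finset.mem_of_mem_filter t ht) ⟨i - 1, hi⟩
      (show i - 1 < r by omega), hη t ht]
    simp only [Nat.sub_add_cancel h1]

theorem exists_index_injOn_of_card_fiber_le {α β : Type*} [DecidableEq β] (T : Finset α)
    (f : α → β) (C : ℕ) (h : ∀ b, (T.filter fun a => f a = b).card ≤ C) :
    ∃ g : α → ℕ, (∀ a ∈ T, g a < C) ∧ ∀ a ∈ T, ∀ a' ∈ T, f a = f a' → g a = g a' → a = a' := by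
  classical
  let e := fun b => (T.filter fun a => f a = b).equivFin
  refine ⟨fun a => if ha : a ∈ T then e (f a) ⟨a, Finset.mem_filter.2 ⟨ha, rfl⟩⟩ else 0, ?_, ?_⟩
  · intro a ha
    simp only [ha, dif_pos]
    exact (Fin.is_lt _).trans_le (h _)
  · intro a ha a' ha' hf hg
    simp only [ha, ha', dif_pos] at hg
    have h2 : ∀ b (x y : T.filter fun a => f a = b), ((e b x : ℕ) = e b y) → x = y :=
      fun b x y hxy => (e b).injective (Fin.ext hxy)
    have h3 : ∀ b b' (hb : b = b') (x : T.filter fun a => f a = b)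
        (y : T.filter fun a => f a = b'), ((e b x : ℕ) = e b' y) → x.1 = y.1 := by
      rintro b _ rfl x y hxy
      rw [h2 b x y hxy]
    exact h3 _ _ hf _ _ hg

/-- The modulus of the congruence determining the `i`-th power sum from the earlier ones. -/
def indexModulus (P : Finset ℕ) (n : ℕ) (k : ℕ → ℕ) (i : ℕ) : ℕ :=
  ∏ p ∈ P with n - k p ≤ i, p

theorem card_le_of_isPowerSumTuple (n : ℕ) (P : Finset ℕ) (hP : ∀ p ∈ P, p.Prime)
    (hPn : ∀ p ∈ P, n < p) (k : ℕ → ℕ) (b : Fin n → ℕ) (S : Finset (Fin n → ℤ))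
    (hSb : ∀ s ∈ S, ∀ i, |s i| ≤ b i)
    (hS : ∀ s ∈ S, ∀ p ∈ P, ∀ [Fact p.Prime],
      IsPowerSumTuple p n (n - k p) (fun i => (s i : ZMod p))) :
    (S.card : ℝ) ≤ (residueBound n : ℝ) ^ P.card *
      ∏ i : Fin n, (2 * b i / indexModulus P n k i + 2 : ℝ) := by
  classical
  have hidx : ∀ p, ∃ g : (Fin n → ZMod p) → ℕ, p ∈ P →
      (∀ s ∈ S, g (fun i => (s i : ZMod p)) < residueBound n) ∧
      ∀ s ∈ S, ∀ s' ∈ S, (∀ i : Fin n, i.1 < n - k p → (s i : ZMod p) = s' i) →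
        g (fun i => (s i : ZMod p)) = g (fun i => (s' i : ZMod p)) →
        ∀ i, (s i : ZMod p) = s' i := by
    intro p
    by_cases hp : p ∈ P
    swap
    · exact ⟨0, fun h => absurd h hp⟩
    have : Fact p.Prime := ⟨hP p hp⟩
    let T : Finset (Fin n → ZMod p) := S.image fun s i => (s i : ZMod p)
    obtain ⟨g, hg1, hg2⟩ := exists_index_injOn_of_card_fiber_le T
      (fun t (i : Fin n) => if i.1 < n - k p then t i else 0) (residueBound n) (by
        intro c
        refine card_isPowerSumTuple_le p n (n - k p) (hPn p hp) c _ ?_ ?_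
        · intro t ht
          obtain ⟨s, hs, rfl⟩ := Finset.mem_image.1 (Finset.mem_filter.1 ht).1
          exact hS s hs p hp
        · intro t ht i hi
          have := congrFun (Finset.mem_filter.1 ht).2 i
          simpa [hi] using this)
    refine ⟨g, fun _ => ⟨fun s hs => hg1 _ (Finset.mem_image_of_mem _ hs), ?_⟩⟩
    intro s hs s' hs' hpre hgs i
    refine congrFun (hg2 _ (Finset.mem_image_of_mem _ hs) _ (Finset.mem_image_of_mem _ hs') ?_ hgs) i
    funext i
    by_cases hi : i.1 < n - k p
    · simp only [hi, if_true, hpre i hi]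
    · simp only [hi, if_false]
  choose g hg using hidx
  let Q : Fin n → ℕ := fun i => indexModulus P n k i
  have hQ : ∀ i, 0 < Q i := fun i =>
    Finset.prod_pos fun p hp => (hP p (Finset.mem_of_mem_filter p hp)).pos
  let F : (Fin n → ℤ) → (P → ℕ) × (Fin n → ℤ) := fun s =>
    (fun p => g p.1 fun i => (s i : ZMod p.1), fun i => s i / Q i)
  let target : Finset ((P → ℕ) × (Fin n → ℤ)) :=
    (Fintype.piFinset fun _ => Finset.range (residueBound n)) ×ˢ
      Fintype.piFinset fun i => Finset.Icc (-(b i : ℤ) / Q i) (b i / Q i)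
  have hmaps : ∀ s ∈ S, F s ∈ target := by
    intro s hs
    simp only [target, F, Finset.mem_product, Fintype.mem_piFinset, Finset.mem_range,
      Finset.mem_Icc]
    refine ⟨fun p => (hg p.1 p.2).1 s hs, fun i => ?_⟩
    have := abs_le.1 (hSb s hs i)
    have hQi : (0 : ℤ) < Q i := by exact_mod_cast hQ i
    exact ⟨Int.ediv_le_ediv hQi this.1, Int.ediv_le_ediv hQi this.2⟩
  have hinj : Set.InjOn F S := by
    intro s hs s' hs' hF
    rw [Prod.mk.injEq] at hF
    obtain ⟨h1, h2⟩ := hF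
    have key : ∀ N (i : Fin n), i.1 = N → s i = s' i := by
      intro N
      induction N using Nat.strong_induction_on with
      | _ N ih =>
        intro i hi
        have hmod : (Q i : ℤ) ∣ s i - s' i := by
          simp only [Q, indexModulus, Nat.cast_prod]
          refine Finset.prod_dvd_of_coprime ?_ ?_
          · intro p hp q hq hpq
            exact Nat.isCoprime_iff_coprime.2 ((Nat.coprime_primes
              (hP p (Finset.mem_of_mem_filter p hp)) (hP q (Finset.mem_of_mem_filter q hq))).2 hpq)
          · intro p hp
            obtain ⟨hp, hpi⟩ := Finset.mem_filter.1 hp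
            have := (hg p hp).2 s hs s' hs' (fun j hj => by rw [ih j.1 (by omega) j rfl])
              (congrFun h1 ⟨p, hp⟩) i
            exact (ZMod.intCast_eq_intCast_iff_dvd_sub _ _ _).1 this.symm
        have hq := congrFun h2 i
        have e1 := Int.emod_add_mul_ediv (s i) (Q i)
        have e2 := Int.emod_add_mul_ediv (s' i) (Q i)
        rw [← e1, ← e2, hq, Int.emod_eq_emod_iff_emod_sub_eq_zero.2 (Int.emod_eq_zero_of_dvd hmod)]
    funext i
    exact key _ i rfl
  have hcard := Finset.card_le_card_of_injOn F hmaps hinj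
  have h3 : (target.card : ℝ) ≤ (residueBound n : ℝ) ^ P.card *
      ∏ i : Fin n, (2 * b i / indexModulus P n k i + 2 : ℝ) := by
    rw [Finset.card_product, Fintype.card_piFinset, Fintype.card_piFinset]
    simp only [Finset.card_range, Finset.prod_const, Finset.card_univ, Fintype.card_coe]
    push_cast
    refine mul_le_mul_of_nonneg_left (Finset.prod_le_prod (fun _ _ => by positivity)
      (g := fun i : Fin n => (2 * b i / indexModulus P n k i + 2 : ℝ)) fun i _ => ?_)
      (by positivity)
    have hQi : (0 : ℤ) < Q i := by exact_mod_cast hQ i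
    have hQr : (0 : ℝ) < Q i := by exact_mod_cast hQ i
    have hle : -(b i : ℤ) / Q i ≤ b i / Q i := Int.ediv_le_ediv hQi (by omega)
    have hnn : (0 : ℤ) ≤ b i / Q i + 1 - -(b i : ℤ) / Q i := by omega
    have h4 : ((Finset.Icc (-(b i : ℤ) / Q i) (b i / Q i)).card : ℝ)
        = ((b i / Q i : ℤ) : ℝ) + 1 - ((-(b i : ℤ) / Q i : ℤ) : ℝ) := by
      rw [Int.card_Icc]
      have := Int.toNat_of_nonneg hnn
      exact_mod_cast this
    have h5 : ((b i / Q i : ℤ) : ℝ) ≤ b i / Q i := by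
      rw [le_div_iff₀ hQr]
      exact_mod_cast Int.ediv_mul_le (b i : ℤ) hQi.ne'
    have h6 : (-(b i) / Q i - 1 : ℝ) ≤ ((-(b i : ℤ) / Q i : ℤ) : ℝ) := by
      have := Int.lt_ediv_add_one_mul_self (-(b i : ℤ)) hQi
      have h7 : (-(b i) : ℝ) < (((-(b i : ℤ) / Q i : ℤ) : ℝ) + 1) * Q i := by exact_mod_cast this
      rw [← div_lt_iff₀ hQr] at h7
      linarith
    rw [h4]
    calc _ ≤ (b i / Q i + 1 - (-(b i) / Q i - 1) : ℝ) := by linarith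
      _ = _ := by ring
  exact le_trans (by exact_mod_cast hcard) h3

theorem Matrix.exists_trace_eq_natCast_of_mul_self {R ι : Type*} [CommRing R]
    [IsLocalRing R] [Fintype ι] [DecidableEq ι] {M : Matrix ι ι R} (h : M * M = M) (h0 : M ≠ 0) :
    ∃ r : ℕ, 1 ≤ r ∧ r ≤ Fintype.card ι ∧ M.trace = r := by
  let f := Matrix.toLin' M
  have hf : IsIdempotentElem f := by
    change Matrix.toLin' M ∘ₗ Matrix.toLin' M = Matrix.toLin' M
    rw [← Matrix.toLin'_mul, h]
  have hc := LinearMap.IsIdempotentElem.isCompl hf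
  let e := Submodule.prodEquivOfIsCompl _ _ hc
  have h1 : Module.Finite R (LinearMap.range f) := Module.Finite.range f
  have h2 : Module.Finite R (LinearMap.ker f) :=
    Module.Finite.of_surjective (LinearMap.snd R _ _ ∘ₗ e.symm.toLinearMap)
      (Prod.snd_surjective.comp e.symm.surjective)
  have h3 : Module.Projective R (LinearMap.range f) :=
    Module.Projective.of_split (e.toLinearMap ∘ₗ LinearMap.inl R _ _)
      (LinearMap.fst R _ _ ∘ₗ e.symm.toLinearMap) (by ext x; simp)
  have h4 : Module.Projective R (LinearMap.ker f) :=
    Module.Projective.of_split (e.toLinearMap ∘ₗ LinearMap.inr R _ _)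
      (LinearMap.snd R _ _ ∘ₗ e.symm.toLinearMap) (by ext x; simp)
  have hfr : Module.Free R (LinearMap.range f) := Module.free_of_flat_of_isLocalRing
  have hkf : Module.Free R (LinearMap.ker f) := Module.free_of_flat_of_isLocalRing
  have htr := (LinearMap.IsIdempotentElem.isProj_range f hf).trace
  have hsum := LinearEquiv.finrank_eq e
  rw [Module.finrank_prod, Module.finrank_fintype_fun_eq_card] at hsum
  refine ⟨_, ?_, by omega, (Matrix.trace_toLin'_eq M).symm.trans htr⟩
  by_contra! hlt
  have : Module.finrank R (LinearMap.range f) = 0 := by omega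
  rw [Module.finrank_eq_zero_iff_of_free, Submodule.subsingleton_iff_eq_bot,
    LinearMap.range_eq_bot] at this
  exact h0 (by simpa [f] using this)

theorem ZMod.isLocalRing_prime_pow (p m : ℕ) [hp : Fact p.Prime] (hm : m ≠ 0) :
    IsLocalRing (ZMod (p ^ m)) := by
  have : Fact (1 < p ^ m) := ⟨Nat.one_lt_pow hm hp.out.one_lt⟩
  exact IsLocalRing.of_surjective' (PadicInt.toZModPow m) (ZMod.ringHom_surjective _)

theorem Algebra.leftMulMatrix_map_castRingHom_eq_zero_iff {S ι : Type*} [CommRing S] [Fintype ι]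
    [DecidableEq ι] (b : Module.Basis ι ℤ S) (N : ℕ) (z : S) :
    (Algebra.leftMulMatrix b z).map (Int.castRingHom (ZMod N)) = 0 ↔ (N : S) ∣ z := by
  constructor
  · intro h
    have h1 (i j : ι) : (N : ℤ) ∣ Algebra.leftMulMatrix b z i j := by
      have := congr_fun (congr_fun h i) j
      rwa [Matrix.map_apply, eq_intCast, Matrix.zero_apply, ZMod.intCast_zmod_eq_zero_iff_dvd]
        at this
    choose c hc using h1
    have h2 : Algebra.leftMulMatrix b z = (N : ℤ) • Matrix.of c := by
      ext i j; simp [hc]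
    have h3 : Algebra.lmul ℤ S z = (N : ℤ) • Matrix.toLin b b (Matrix.of c) := by
      rw [← map_smul, ← h2, Algebra.leftMulMatrix_apply, Matrix.toLin_toMatrix]
    have h4 := LinearMap.congr_fun h3 1
    refine ⟨Matrix.toLin b b (Matrix.of c) 1, ?_⟩
    simpa using h4
  · rintro ⟨w, rfl⟩
    rw [map_mul, map_natCast, ← nsmul_eq_mul]
    ext i j
    rw [Matrix.map_apply, Matrix.smul_apply]
    simp

theorem Algebra.exists_trace_cast_eq_natCast {S ι : Type*} [CommRing S] [Fintype ι]
    (b : Module.Basis ι ℤ S) (N : ℕ) [IsLocalRing (ZMod N)] (x : S)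
    (h : (N : S) ∣ x * x - x) (h0 : ¬ (N : S) ∣ x) :
    ∃ r : ℕ, 1 ≤ r ∧ r ≤ Fintype.card ι ∧ ((Algebra.trace ℤ S x : ℤ) : ZMod N) = r := by
  classical
  obtain ⟨r, h1, h2, h3⟩ := Matrix.exists_trace_eq_natCast_of_mul_self
    (M := (Algebra.leftMulMatrix b x).map (Int.castRingHom (ZMod N))) (by
      rw [← Algebra.leftMulMatrix_map_castRingHom_eq_zero_iff b, map_sub, map_mul,
        Matrix.map_sub _ (map_sub _), Matrix.map_mul, sub_eq_zero] at h
      exact h) (by rwa [Ne, Algebra.leftMulMatrix_map_castRingHom_eq_zero_iff])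
  refine ⟨r, h1, h2, ?_⟩
  rw [Algebra.trace_eq_matrix_trace b, ← h3, Matrix.trace, Matrix.trace]
  simp

open NumberField in
theorem NumberField.not_pow_dvd_differentIdeal {K : Type*} [Field K] [NumberField K] (p m e : ℕ)
    [hp : Fact p.Prime] (hm : Module.finrank ℚ K < p ^ m) {P Q : Ideal (𝓞 K)} (hP : P ≠ ⊤)
    (he : e ≠ 0)
    (hPQ : P ^ e * Q = Ideal.span {(p : 𝓞 K)}) (hco : IsCoprime P Q) :
    ¬ P ^ (e * m) ∣ differentIdeal ℤ (𝓞 K) := by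
  have hn : 0 < Module.finrank ℚ K := Module.finrank_pos
  have hm0 : m ≠ 0 := by rintro rfl; simp at hm; omega
  have hco' : IsCoprime (P ^ (e * m)) (Q ^ m) := hco.pow
  have hmul : P ^ (e * m) * Q ^ m = Ideal.span {((p ^ m : ℕ) : 𝓞 K)} := by
    rw [pow_mul, ← mul_pow, hPQ, Ideal.span_singleton_pow, Nat.cast_pow]
  obtain ⟨y, hy, x, hx, hxy⟩ := Ideal.isCoprime_iff_exists.1 hco'
  refine not_dvd_differentIdeal_of_intTrace_not_mem ℤ (p := Ideal.span {((p ^ m : ℕ) : ℤ)})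
    (P ^ (e * m)) (Q ^ m) ?_ x hx ?_
  · rw [hmul, Ideal.map_span]; simp
  · have hloc := ZMod.isLocalRing_prime_pow p m hm0
    obtain ⟨r, h1, h2, h3⟩ := Algebra.exists_trace_cast_eq_natCast
      (Module.finBasis ℤ (𝓞 K)) (p ^ m) x (by
        rw [← Ideal.mem_span_singleton, ← hmul]
        have : x * x - x = - (y * x) := by rw [← eq_sub_iff_add_eq] at hxy; rw [hxy]; ring
        rw [this]
        exact neg_mem (Ideal.mul_mem_mul hy hx)) (by
        intro h
        have : x ∈ P ^ (e * m) := by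
          rw [← Ideal.mem_span_singleton, ← hmul] at h
          exact (Ideal.mul_le_left : P ^ (e * m) * Q ^ m ≤ _) h
        have h1 := add_mem hy this
        rw [hxy] at h1
        exact hP ((Ideal.eq_top_iff_one _).2 (Ideal.pow_le_self (Nat.mul_ne_zero he hm0) h1)))
    rw [Algebra.intTrace_eq_trace, Ideal.mem_span_singleton]
    intro h
    rw [(ZMod.intCast_zmod_eq_zero_iff_dvd _ _).2 h, eq_comm, ZMod.natCast_eq_zero_iff] at h3
    have := Nat.le_of_dvd (by omega) h3
    rw [Fintype.card_fin, RingOfIntegers.rank] at h2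
    omega

open UniqueFactorizationMonoid in
theorem Ideal.exists_mul_of_count_lt {S : Type*} [CommRing S] [IsDedekindDomain S]
    [DecidableEq (Ideal S)] {I J : Ideal S} (hI : I ≠ ⊥) (hJ : J ≠ ⊥) (m : ℕ)
    (h : ∀ P ∈ normalizedFactors I,
      (normalizedFactors J).count P <
        m * (normalizedFactors I).count P) :
    ∃ A C R : Ideal S, A * C = J ∧ A * R ∣ I ^ m ∧ R ∣ I ∧
      (∀ P : Ideal S, P.IsPrime → I ≤ P → R ≤ P ∧ ¬ P ∣ C) := by
  have hdec : DecidablePred fun P : Ideal S => P ∣ I := Classical.decPred _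
  let s := (normalizedFactors J).filter (· ∣ I)
  let t := (normalizedFactors J).filter (¬ · ∣ I)
  let r := (normalizedFactors I).dedup
  have hmem {P : Ideal S} (hP : P.IsPrime) (hIP : I ≤ P) : P ∈ normalizedFactors I :=
    (Ideal.mem_normalizedFactors_iff hI).2 ⟨hP, hIP⟩
  refine ⟨s.prod, t.prod, r.prod, ?_, ?_, ?_, fun P hP hIP => ⟨?_, ?_⟩⟩
  · rw [← Multiset.prod_add, show s + t = _ from Multiset.filter_add_not _ _, prod_normalizedFactors_eq hJ, normalize_eq]
  · rw [← Multiset.prod_add]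
    have hle : s + r ≤ m • normalizedFactors I := by
      rw [Multiset.le_iff_count]
      intro P
      rw [Multiset.count_add, Multiset.count_nsmul]
      by_cases hP : P ∈ normalizedFactors I
      · have h1 := h P hP
        have h2 : s.count P ≤ (normalizedFactors J).count P :=
          Multiset.count_le_of_le _ (Multiset.filter_le _ _)
        have h3 : r.count P ≤ 1 := Multiset.nodup_iff_count_le_one.1 (Multiset.nodup_dedup _) P
        omega
      · have h2 : s.count P = 0 := by
          rw [Multiset.count_eq_zero]
          intro h4
          obtain ⟨h5, h6⟩ := Multiset.mem_filter.1 h4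
          exact hP (hmem ((Ideal.mem_normalizedFactors_iff hJ).1 h5).1 (Ideal.le_of_dvd h6))
        have h3 : r.count P = 0 := by
          rwa [Multiset.count_eq_zero, Multiset.mem_dedup]
        omega
    have := Multiset.prod_dvd_prod_of_le hle
    rwa [Multiset.prod_nsmul, prod_normalizedFactors_eq hI, normalize_eq] at this
  · have := Multiset.prod_dvd_prod_of_le (Multiset.dedup_le (normalizedFactors I))
    rwa [prod_normalizedFactors_eq hI, normalize_eq] at this
  · exact Ideal.le_of_dvd (Multiset.dvd_prod (Multiset.mem_dedup.2 (hmem hP hIP)))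
  · intro hPt
    have hprime := prime_of_normalized_factor P (hmem hP hIP)
    obtain ⟨a, ha, hPa⟩ := hprime.exists_mem_multiset_dvd hPt
    obtain ⟨h5, h6⟩ := Multiset.mem_filter.1 ha
    have : P = a := by
      have := (hprime.dvd_prime_iff_associated (prime_of_normalized_factor a h5)).1 hPa
      exact associated_iff_eq.1 this
    exact h6 (this ▸ Ideal.dvd_iff_le.2 hIP)

open NumberField UniqueFactorizationMonoid in
theorem NumberField.count_differentIdeal_lt {K : Type*} [Field K] [NumberField K]
    [DecidableEq (Ideal (𝓞 K))] (p m : ℕ)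
    [hp : Fact p.Prime] (hm : Module.finrank ℚ K < p ^ m) {P : Ideal (𝓞 K)}
    (hP : P ∈ normalizedFactors (Ideal.span {(p : 𝓞 K)})) :
    (normalizedFactors (differentIdeal ℤ (𝓞 K))).count P <
      m * (normalizedFactors (Ideal.span {(p : 𝓞 K)})).count P := by
  have hI : Ideal.span {(p : 𝓞 K)} ≠ ⊥ := by
    rw [Ne, Ideal.span_singleton_eq_bot, Nat.cast_eq_zero]
    exact hp.out.ne_zero
  have hprime := prime_of_normalized_factor P hP
  obtain ⟨hPp, hIP⟩ := (Ideal.mem_normalizedFactors_iff hI).1 hP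
  have hmax : P.IsMaximal := hPp.isMaximal hprime.ne_zero
  have hfm := FiniteMultiplicity.of_prime_left hprime hI
  obtain ⟨Q, hQ, hPQ⟩ := hfm.exists_eq_pow_mul_and_not_dvd
  have hcnt : multiplicity P (Ideal.span {(p : 𝓞 K)}) =
      (normalizedFactors (Ideal.span {(p : 𝓞 K)})).count P := by
    have h1 := emultiplicity_eq_count_normalizedFactors hprime.irreducible hI
    rw [hfm.emultiplicity_eq_multiplicity, normalize_eq] at h1
    exact_mod_cast h1
  rw [hcnt] at hQ
  by_contra! hlt
  refine NumberField.not_pow_dvd_differentIdeal p m _ hm hPp.ne_top ?_ hQ.symm ?_ ?_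
  · exact Multiset.count_ne_zero.2 hP
  · rw [Ideal.isCoprime_iff_sup_eq]
    refine hmax.1.2 _ (lt_of_le_of_ne le_sup_left fun h => hPQ ?_)
    rw [Ideal.dvd_iff_le, h]
    exact le_sup_right
  · rw [pow_dvd_iff_le_emultiplicity, emultiplicity_eq_count_normalizedFactors hprime.irreducible
      differentIdeal_ne_bot, normalize_eq, mul_comm]
    exact_mod_cast hlt

open NumberField in
/-- An ideal `R` contained in all primes above `p`, whose norm bounds the power of `p` in the
discriminant. -/
theorem NumberField.exists_ideal_padicValNat_discr_add_le {K : Type*} [Field K] [NumberField K]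
    (p m : ℕ) [hp : Fact p.Prime] (hm : Module.finrank ℚ K < p ^ m) :
    ∃ (R : Ideal (𝓞 K)) (d : ℕ), (∀ P : Ideal (𝓞 K), P.IsPrime → (p : 𝓞 K) ∈ P → R ≤ P) ∧
      (p : 𝓞 K) ∈ R ∧ R.absNorm = p ^ d ∧ padicValNat p (discr K).natAbs + d ≤ m * Module.finrank ℚ K := by
  classical
  have hI : Ideal.span {(p : 𝓞 K)} ≠ ⊥ := by
    rw [Ne, Ideal.span_singleton_eq_bot, Nat.cast_eq_zero]
    exact hp.out.ne_zero
  obtain ⟨A, C, R, h1, h2, hRI, h3⟩ := Ideal.exists_mul_of_count_lt hI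
    (differentIdeal_ne_bot (A := ℤ) (B := 𝓞 K)) m
    fun P hP => NumberField.count_differentIdeal_lt p m hm hP
  have hdvd : A.absNorm * R.absNorm ∣ p ^ (m * Module.finrank ℚ K) := by
    have := map_dvd Ideal.absNorm h2
    rwa [map_mul, map_pow, Ideal.absNorm_span_natCast, RingOfIntegers.rank, ← pow_mul,
      mul_comm _ m] at this
  obtain ⟨d, -, hd⟩ := (Nat.dvd_prime_pow hp.out).1 (dvd_of_mul_left_dvd hdvd)
  obtain ⟨a, -, ha⟩ := (Nat.dvd_prime_pow hp.out).1 (dvd_of_mul_right_dvd hdvd)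
  have hC : ¬ p ∣ C.absNorm := by
    intro hC
    obtain ⟨P, hP, hPp, hPC⟩ := Ideal.exists_isMaximal_dvd_of_dvd_absNorm
      (Nat.prime_iff_prime_int.1 hp.out) C (by exact_mod_cast hC)
    refine (h3 P hP.isPrime ?_).2 hPC
    rw [Ideal.span_singleton_le_iff_mem]
    have : (p : ℤ) ∈ P.under ℤ := hPp ▸ Ideal.mem_span_singleton_self _
    simpa [Ideal.under, Ideal.mem_comap] using this
  refine ⟨R, d, fun P hP hpP => (h3 P hP ((Ideal.span_singleton_le_iff_mem _).2 hpP)).1,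
    (Ideal.span_singleton_le_iff_mem _).1 (Ideal.le_of_dvd hRI), hd, ?_⟩
  have hD : (discr K).natAbs = p ^ a * C.absNorm := by
    rw [← absNorm_differentIdeal K (𝓞 K), ← h1, map_mul, ha]
  have hC0 : C.absNorm ≠ 0 := by rintro h; rw [h] at hC; simp at hC
  rw [hD, padicValNat.mul (pow_ne_zero _ hp.out.ne_zero) hC0, padicValNat.prime_pow,
    padicValNat.eq_zero_of_not_dvd hC, add_zero]
  rw [ha, hd, ← pow_add, Nat.pow_dvd_pow_iff_le_right hp.out.one_lt] at hdvd
  exact hdvd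

/-- Reduction of algebraic integers modulo a prime above `p`. -/
theorem exists_integralClosure_ringHom (Ω : Type*) [Field Ω] [CharZero Ω] (p : ℕ)
    [hp : Fact p.Prime] : Nonempty (integralClosure ℤ Ω →+* AlgebraicClosure (ZMod p)) := by
  have hmax : (Ideal.span {(p : ℤ)}).IsMaximal := Int.ideal_span_isMaximal_of_prime p
  obtain ⟨Q, hQ, hQp⟩ := Ideal.exists_maximal_ideal_liesOver_of_isIntegral
    (S := integralClosure ℤ Ω) (Ideal.span {(p : ℤ)})
  let _ : Field (integralClosure ℤ Ω ⧸ Q) := Ideal.Quotient.field Q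
  have hpQ : ((p : ℤ) : integralClosure ℤ Ω) ∈ Q := by
    have h1 : (p : ℤ) ∈ Q.under ℤ := hQp.over ▸ Ideal.mem_span_singleton_self _
    simpa only [Ideal.under, Ideal.mem_comap, eq_intCast] using h1
  have hch : CharP (integralClosure ℤ Ω ⧸ Q) p := by
    rw [CharP.charP_iff_prime_eq_zero hp.out, ← map_natCast (Ideal.Quotient.mk Q),
      Ideal.Quotient.eq_zero_iff_mem]
    exact_mod_cast hpQ
  let _ : Algebra (ZMod p) (integralClosure ℤ Ω ⧸ Q) := ZMod.algebra _ p
  have h_integral : Algebra.IsIntegral (ZMod p) (integralClosure ℤ Ω ⧸ Q) := by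
    refine ⟨fun x => ?_⟩
    obtain ⟨y, rfl⟩ := Ideal.Quotient.mk_surjective x
    obtain ⟨f, hf, hf0⟩ := Algebra.IsIntegral.isIntegral (R := ℤ) y
    refine ⟨f.map (Int.castRingHom (ZMod p)), hf.map _, ?_⟩
    rw [Polynomial.eval₂_map, RingHom.ext_int ((algebraMap (ZMod p) _).comp _)
      ((Ideal.Quotient.mk Q).comp (algebraMap ℤ _)), ← Polynomial.hom_eval₂, hf0, map_zero]
  have halg : Algebra.IsAlgebraic (ZMod p) (integralClosure ℤ Ω ⧸ Q) := h_integral.isAlgebraic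
  exact ⟨((IsAlgClosed.lift : (integralClosure ℤ Ω ⧸ Q) →ₐ[ZMod p] AlgebraicClosure (ZMod p)) :
    _ →+* _).comp (Ideal.Quotient.mk Q)⟩

theorem Ideal.exists_finset_eval_of_absNorm_eq_pow {S : Type*} [CommRing S] [IsDedekindDomain S]
    [Module.Free ℤ S] (p : ℕ) [hp : Fact p.Prime] (R : Ideal S) (d : ℕ)
    (hR : R.absNorm = p ^ d) (hpR : (p : S) ∈ R) {k : Type*} [Field k] (α : S) :
    ∃ F : Finset k, F.card ≤ d ∧ ∀ φ : S →+* k, (∀ x ∈ R, φ x = 0) → φ α ∈ F := by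
  classical
  by_cases hne : Nontrivial (S ⧸ R)
  · have hch : CharP (S ⧸ R) p := by
      rw [CharP.charP_iff_prime_eq_zero hp.out, ← map_natCast (Ideal.Quotient.mk R),
        Ideal.Quotient.eq_zero_iff_mem]
      exact hpR
    let _ : Algebra (ZMod p) (S ⧸ R) := ZMod.algebra _ p
    have hcard : Nat.card (S ⧸ R) = p ^ d := by
      rw [← hR, Ideal.absNorm_apply, Submodule.cardQuot_apply]
    have hfin : Finite (S ⧸ R) := by
      refine Nat.finite_of_card_ne_zero ?_
      rw [hcard]
      exact pow_ne_zero _ hp.out.ne_zero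
    have hrank : Module.finrank (ZMod p) (S ⧸ R) = d := by
      have h1 := Module.natCard_eq_pow_finrank (K := ZMod p) (V := S ⧸ R)
      rw [hcard, Nat.card_zmod] at h1
      exact (Nat.pow_right_injective hp.out.two_le h1).symm
    by_cases hφ : ∃ φ : S →+* k, (∀ x ∈ R, φ x = 0)
    · obtain ⟨φ₀, hφ₀⟩ := hφ
      have hck : CharP k p := by
        rw [CharP.charP_iff_prime_eq_zero hp.out, ← map_natCast φ₀]
        exact hφ₀ _ hpR
      let _ : Algebra (ZMod p) k := ZMod.algebra _ p
      let q := ((Algebra.lmul (ZMod p) (S ⧸ R) (Ideal.Quotient.mk R α)).charpoly).map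
        (algebraMap (ZMod p) k)
      have hq : q.Monic := (LinearMap.charpoly_monic _).map _
      have hq0 : Polynomial.aeval (Ideal.Quotient.mk R α)
          (Algebra.lmul (ZMod p) (S ⧸ R) (Ideal.Quotient.mk R α)).charpoly = 0 := by
        have h1 := LinearMap.aeval_self_charpoly
          (Algebra.lmul (ZMod p) (S ⧸ R) (Ideal.Quotient.mk R α))
        rw [Polynomial.aeval_algHom_apply] at h1
        have h2 := LinearMap.congr_fun h1 1
        simpa using h2
      refine ⟨q.roots.toFinset, ?_, fun φ hφ => ?_⟩
      · refine (Multiset.toFinset_card_le _).trans ((Polynomial.card_roots' _).trans ?_)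
        rw [(LinearMap.charpoly_monic _).natDegree_map, LinearMap.charpoly_natDegree, hrank]
      · rw [Multiset.mem_toFinset, Polynomial.mem_roots hq.ne_zero,
          Polynomial.IsRoot.def, Polynomial.eval_map]
        have hcomp : algebraMap (ZMod p) k =
            (Ideal.Quotient.lift R φ hφ).comp (algebraMap (ZMod p) (S ⧸ R)) :=
          RingHom.ext_zmod _ _
        have hφα : φ α = Ideal.Quotient.lift R φ hφ (Ideal.Quotient.mk R α) := by simp
        rw [hcomp, hφα, ← Polynomial.hom_eval₂]
        exact (congrArg _ hq0).trans (map_zero _)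
    · exact ⟨∅, by simp, fun φ h => (hφ ⟨φ, h⟩).elim⟩
  · rw [Ideal.Quotient.nontrivial_iff, not_not] at hne
    refine ⟨∅, by simp, fun φ h => ?_⟩
    have := h 1 (hne ▸ Submodule.mem_top)
    simp at this

/-- Restriction of an embedding of number fields to algebraic integers. -/
def NumberField.ringOfIntegersToIntegralClosure {K Ω : Type*} [Field K] [Field Ω] (φ : K →+* Ω) :
    NumberField.RingOfIntegers K →+* integralClosure ℤ Ω :=
  (φ.comp (algebraMap (NumberField.RingOfIntegers K) K)).codRestrict
    (integralClosure ℤ Ω) fun x => by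
      have h := NumberField.RingOfIntegers.isIntegral_coe x
      exact h.map (φ.toIntAlgHom)

theorem NumberField.coe_ringOfIntegersToIntegralClosure {K Ω : Type*} [Field K] [Field Ω]
    (φ : K →+* Ω) (x : NumberField.RingOfIntegers K) :
    (NumberField.ringOfIntegersToIntegralClosure φ x : Ω) = φ x :=
  rfl

open NumberField in
theorem NumberField.isPowerSumTuple_trace_pow {K : Type*} [Field K] [NumberField K] {n : ℕ}
    (hn : Module.finrank ℚ K = n) (p : ℕ) [hp : Fact p.Prime] (hpn : n < p) (α : 𝓞 K) :
    IsPowerSumTuple p n (n - padicValNat p (discr K).natAbs)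
      (fun i => ((Algebra.trace ℤ (𝓞 K) (α ^ (i.1 + 1)) : ℤ) : ZMod p)) := by
  obtain ⟨R, d, hR, hpR, hRd, hd⟩ := NumberField.exists_ideal_padicValNat_discr_add_le (K := K) p 1
    (by rwa [hn, pow_one])
  rw [hn, one_mul] at hd
  obtain ⟨ψ⟩ := exists_integralClosure_ringHom (AlgebraicClosure ℚ) p
  let e : (K →ₐ[ℚ] AlgebraicClosure ℚ) ≃ Fin n :=
    Fintype.equivFinOfCardEq (by rw [AlgHom.card, hn])
  let Φ (j : K →ₐ[ℚ] AlgebraicClosure ℚ) : 𝓞 K →+* AlgebraicClosure (ZMod p) :=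
    ψ.comp (ringOfIntegersToIntegralClosure (j : K →+* AlgebraicClosure ℚ))
  refine ⟨fun i => Φ (e.symm i) α, ?_, fun i => ?_⟩
  · obtain ⟨F, hF, hφ⟩ := Ideal.exists_finset_eval_of_absNorm_eq_pow p R d hRd hpR
      (k := AlgebraicClosure (ZMod p)) α
    have hsub : Set.range (fun i => Φ (e.symm i) α) ⊆ F := by
      rintro _ ⟨i, rfl⟩
      refine hφ (Φ (e.symm i)) fun x hx => ?_
      refine hR (RingHom.ker (Φ (e.symm i))) (RingHom.ker_isPrime _) ?_ hx
      rw [RingHom.mem_ker, map_natCast, CharP.cast_eq_zero]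
    have := Set.ncard_le_ncard hsub F.finite_toSet
    rw [Set.ncard_coe_finset] at this
    omega
  · rw [map_intCast, e.symm.sum_comp (fun j => Φ j α ^ (i.1 + 1))]
    have h1 : ((Algebra.trace ℤ (𝓞 K) (α ^ (i.1 + 1)) : ℤ) : integralClosure ℤ (AlgebraicClosure ℚ))
        = ∑ j : K →ₐ[ℚ] AlgebraicClosure ℚ,
          ringOfIntegersToIntegralClosure (j : K →+* AlgebraicClosure ℚ) α ^ (i.1 + 1) := by
      apply Subtype.ext
      have h2 := trace_eq_sum_embeddings (K := ℚ) (AlgebraicClosure ℚ) (x := ((α ^ (i.1 + 1) : 𝓞 K) : K))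
      rw [← Algebra.coe_trace_int] at h2
      rw [AddSubmonoidClass.coe_finsetSum]
      simpa [NumberField.coe_ringOfIntegersToIntegralClosure] using h2
    exact (map_intCast ψ _).symm.trans ((congrArg ψ h1).trans (by simp [Φ]))

open NumberField in
theorem NumberField.padicValNat_discr_le (K : Type*) [Field K] [NumberField K] (p : ℕ)
    [hp : Fact p.Prime] :
    padicValNat p (discr K).natAbs ≤ Module.finrank ℚ K * Module.finrank ℚ K := by
  obtain ⟨-, d, -, -, -, hd⟩ := NumberField.exists_ideal_padicValNat_discr_add_le (K := K) p
    (Module.finrank ℚ K) (Nat.lt_pow_self hp.out.one_lt)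
  omega

open NumberField in
theorem NumberField.padicValNat_discr_lt (K : Type*) [Field K] [NumberField K] (p : ℕ)
    [hp : Fact p.Prime] (hpn : Module.finrank ℚ K < p) :
    padicValNat p (discr K).natAbs < Module.finrank ℚ K := by
  obtain ⟨R, d, hR, -, hRd, hd⟩ := NumberField.exists_ideal_padicValNat_discr_add_le (K := K) p 1
    (by rwa [pow_one])
  suffices d ≠ 0 by omega
  rintro rfl
  rw [pow_zero, Ideal.absNorm_eq_one_iff] at hRd
  obtain ⟨ψ⟩ := exists_integralClosure_ringHom (AlgebraicClosure ℚ) p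
  let φ : K →+* AlgebraicClosure ℚ := (IsAlgClosed.lift : K →ₐ[ℚ] AlgebraicClosure ℚ)
  let Φ := ψ.comp (ringOfIntegersToIntegralClosure φ)
  have h1 := hR (RingHom.ker Φ) (RingHom.ker_isPrime _) (by
    rw [RingHom.mem_ker, map_natCast, CharP.cast_eq_zero])
  rw [hRd] at h1
  have h2 := h1 (Submodule.mem_top (x := 1))
  rw [RingHom.mem_ker, map_one] at h2
  exact one_ne_zero h2

theorem Matrix.exists_mul_mul_eq_one {F m n : Type*} [Field F] [Fintype m] [Fintype n]
    [DecidableEq m] [DecidableEq n] (M : Matrix m n F) :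
    ∃ (A : Matrix (Fin M.rank) m F) (B : Matrix n (Fin M.rank) F), A * M * B = 1 := by
  let f := Matrix.toLin' M
  have hr : Module.finrank F (LinearMap.range f) = M.rank := by
    rw [Matrix.rank, ← Matrix.toLin'_apply']
  let b := Module.finBasisOfFinrankEq F (LinearMap.range f) hr
  choose u hu using fun i => (b i).2
  let g : (Fin M.rank → F) →ₗ[F] (m → F) := (LinearMap.range f).subtype ∘ₗ b.equivFun.symm
  have hg : LinearMap.ker g = ⊥ := by
    rw [LinearMap.ker_eq_bot]
    exact Subtype.val_injective.comp b.equivFun.symm.injective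
  obtain ⟨l, hl⟩ := LinearMap.exists_leftInverse_of_injective g hg
  refine ⟨LinearMap.toMatrix' l, (Matrix.of u).transpose, ?_⟩
  have hfu : f ∘ₗ Matrix.toLin' (Matrix.of u).transpose = g := by
    refine LinearMap.pi_ext' fun i => LinearMap.ext_ring ?_
    have h1 : (Matrix.of u).transpose.mulVec (Pi.single i 1) = u i := by
      ext j; simp
    simp only [LinearMap.comp_apply, LinearMap.coe_single, Matrix.toLin'_apply, h1]
    simp [g, hu]
  apply Matrix.toLin'.injective
  rw [Matrix.mul_assoc, Matrix.toLin'_mul, Matrix.toLin'_mul, hfu, Matrix.toLin'_toMatrix', hl,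
    Matrix.toLin'_one]

theorem Matrix.rank_le_of_map_eq_mul {F k m n ι : Type*} [Field F] [Field k] [Fintype m] [Fintype n]
    [Fintype ι] (φ : F →+* k) (M : Matrix m n F) (A : Matrix m ι k) (B : Matrix ι n k)
    (h : M.map φ = A * B) : M.rank ≤ Fintype.card ι := by
  classical
  obtain ⟨C, D, hCD⟩ := M.exists_mul_mul_eq_one
  have h1 := congrArg (fun N => N.map φ) hCD
  simp only [Matrix.map_mul, Matrix.map_one φ (map_zero φ) (map_one φ), h] at h1
  have h2 := congrArg Matrix.rank h1
  rw [Matrix.rank_one, Fintype.card_fin, ← Matrix.mul_assoc, Matrix.mul_assoc] at h2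
  calc M.rank = _ := h2.symm
    _ ≤ _ := (Matrix.rank_mul_le_left _ _).trans (Matrix.rank_le_card_width _)

theorem Matrix.pow_dvd_det_of_rank_le {ι : Type*} [Fintype ι] [DecidableEq ι] (p : ℕ)
    [hp : Fact p.Prime] (T : Matrix ι ι ℤ) (r : ℕ)
    (hr : (T.map (Int.castRingHom (ZMod p))).rank ≤ r) :
    (p : ℤ) ^ (Fintype.card ι - r) ∣ T.det := by
  let M := T.map (Int.castRingHom (ZMod p))
  let f := Matrix.toLin' M
  obtain ⟨W, hW⟩ := (LinearMap.ker f).exists_isCompl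
  let b := (((Module.finBasis (ZMod p) (LinearMap.ker f)).prod (Module.finBasis (ZMod p) W)).map
    (Submodule.prodEquivOfIsCompl _ _ hW))
  have hcard : Fintype.card ι = Module.finrank (ZMod p) (LinearMap.ker f) +
      Module.finrank (ZMod p) W := by
    have := Submodule.finrank_add_eq_of_isCompl hW
    rw [this, Module.finrank_fintype_fun_eq_card]
  have hker : Fintype.card ι - r ≤ Module.finrank (ZMod p) (LinearMap.ker f) := by
    have h1 := LinearMap.finrank_range_add_finrank_ker f
    have h2 : Module.finrank (ZMod p) (LinearMap.range f) = M.rank := by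
      rw [Matrix.rank, ← Matrix.toLin'_apply']
    rw [Module.finrank_fintype_fun_eq_card] at h1
    change M.rank ≤ r at hr
    omega
  let e : Fin _ ⊕ Fin _ ≃ ι := b.indexEquiv (Pi.basisFun (ZMod p) ι)
  let b' := b.reindex e
  let B : Matrix ι ι ℤ := Matrix.of fun i j => ((b' j i).val : ℤ)
  have hB : B.map (Int.castRingHom (ZMod p)) = (Pi.basisFun (ZMod p) ι).toMatrix b' := by
    ext i j
    simp [B, Module.Basis.toMatrix_apply]
  have hdet : ¬ (p : ℤ) ∣ B.det := by
    rw [← ZMod.intCast_zmod_eq_zero_iff_dvd, ← eq_intCast (Int.castRingHom (ZMod p)),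
      RingHom.map_det, RingHom.mapMatrix_apply, hB, ← Module.Basis.det_apply]
    exact (Module.Basis.isUnit_det (Pi.basisFun (ZMod p) ι) b').ne_zero
  have hcol (j : Fin (Module.finrank (ZMod p) (LinearMap.ker f))) (i : ι) :
      (p : ℤ) ∣ (T * B) i (e (Sum.inl j)) := by
    have h1 : f (b' (e (Sum.inl j))) = 0 := by
      have : b' (e (Sum.inl j)) = Module.finBasis (ZMod p) (LinearMap.ker f) j := by
        simp [b', b]
      rw [this]
      exact (Module.finBasis (ZMod p) (LinearMap.ker f) j).2
    rw [← ZMod.intCast_zmod_eq_zero_iff_dvd, ← eq_intCast (Int.castRingHom (ZMod p))]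
    have h2 := congr_fun h1 i
    rw [Matrix.toLin'_apply, Matrix.mulVec, dotProduct, Pi.zero_apply] at h2
    rw [Matrix.mul_apply, map_sum, ← h2]
    refine Finset.sum_congr rfl fun x _ => ?_
    simp [M, B]
  choose q hq using hcol
  let v : ι → ℤ := fun j => Sum.elim (fun _ => (p : ℤ)) (fun _ => 1) (e.symm j)
  let C : Matrix ι ι ℤ := Matrix.of fun i j =>
    Sum.elim (fun x => q x i) (fun _ => (T * B) i j) (e.symm j)
  have hTB : T * B = Matrix.of fun i j => v j * C i j := by
    ext i j
    obtain ⟨x, rfl⟩ := e.surjective j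
    rcases x with x | x
    · simp only [hq, v, C, Matrix.of_apply, Equiv.symm_apply_apply, Sum.elim_inl]
    · simp [v, C]
  have hdvd : (p : ℤ) ^ Module.finrank (ZMod p) (LinearMap.ker f) ∣ T.det * B.det := by
    rw [← Matrix.det_mul, hTB, Matrix.det_mul_row, ← e.prod_comp]
    refine Dvd.intro (C.det) ?_
    simp [v, Fintype.prod_sum_type]
  have hcop : IsCoprime ((p : ℤ) ^ Module.finrank (ZMod p) (LinearMap.ker f)) B.det :=
    ((Nat.prime_iff_prime_int.1 hp.out).coprime_iff_not_dvd.2 hdet).pow_left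
  exact (pow_dvd_pow _ hker).trans (hcop.dvd_of_dvd_mul_right hdvd)

open NumberField in
theorem NumberField.exists_inertia_of_dvd_discr (L : Type*) [Field L] [NumberField L] [IsGalois ℚ L]
    (p : ℕ) [hp : Fact p.Prime] (hpL : (p : ℤ) ∣ discr L) :
    ∃ P : Ideal (𝓞 L), P.IsMaximal ∧ (p : 𝓞 L) ∈ P ∧
      ∃ g : L ≃ₐ[ℚ] L, g ≠ 1 ∧ ∀ x : 𝓞 L, g • x - x ∈ P := by
  have hpz : Prime (p : ℤ) := Nat.prime_iff_prime_int.1 hp.out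
  have h := mt (NumberField.not_dvd_discr_iff_forall_liesOver L (𝓞 L) hpz).2 (not_not.2 hpL)
  push Not at h
  obtain ⟨P, hP, hPp, hPu⟩ := h
  have hmax : (Ideal.span {(p : ℤ)}).IsMaximal := Int.ideal_span_isMaximal_of_prime p
  refine ⟨P, hP, ?_, ?_⟩
  · have h1 : (p : ℤ) ∈ P.under ℤ := hPp.over ▸ Ideal.mem_span_singleton_self _
    simpa [Ideal.under, Ideal.mem_comap] using h1
  · have hfin : Finite (ℤ ⧸ Ideal.span {(p : ℤ)}) :=
      Finite.of_equiv _ (Int.quotientSpanNatEquivZMod p).symm.toEquiv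
    have hcard := Ideal.card_inertia_eq_ramificationIdxIn (G := L ≃ₐ[ℚ] L)
      (Ideal.span {(p : ℤ)}) P
    rw [Ideal.ramificationIdxIn_eq_ramificationIdx _ P (L ≃ₐ[ℚ] L)] at hcard
    have h1 : Nat.card (Ideal.inertia (L ≃ₐ[ℚ] L) P) ≠ 1 := by
      rw [hcard, Ne, Ideal.ramificationIdx_eq_one_iff]
      exact hPu
    have h2 : Ideal.inertia (L ≃ₐ[ℚ] L) P ≠ ⊥ := fun h => h1 (by rw [h, Subgroup.card_bot])
    obtain ⟨g, hg1⟩ := Subgroup.ne_bot_iff_exists_ne_one.1 h2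
    exact ⟨g.1, fun h => hg1 (Subtype.ext h), g.2⟩

theorem normal_Qbar : Normal ℚ Qbar := by
  have h : Algebra.IsAlgebraic ℚ Qbar :=
    ⟨fun x => by
      obtain ⟨q, hq0, hq⟩ := (AlgebraicClosure.isAlgebraic ℚ).isAlgebraic x
      refine ⟨q, hq0, ?_⟩
      rw [Polynomial.aeval_def] at hq ⊢
      rwa [Subsingleton.elim (algebraMap ℚ Qbar) _]⟩
  exact normal_iff.2 fun x => ⟨(h.isAlgebraic x).isIntegral, IsAlgClosed.splits _⟩

theorem Equiv.Perm.apply_zpow_apply_eq {α β : Type*} (τ : Equiv.Perm α) (f : α → β)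
    (h : ∀ x, f (τ x) = f x) (k : ℤ) (x : α) : f ((τ ^ k) x) = f x := by
  induction k with
  | zero => simp
  | succ i ih => rw [zpow_add_one, ← ih, (Commute.zpow_self τ _).eq, Equiv.Perm.mul_apply, h]
  | pred i ih =>
    rw [← ih, ← h, ← Equiv.Perm.mul_apply, ← zpow_one_add]
    congr 3
    ring

theorem rank_le_permOrbitCount {n : ℕ} (τ : Equiv.Perm (Fin n)) {F k : Type*} [Field F] [Field k]
    (φ : F →+* k) (T : Matrix (Fin n) (Fin n) F) (M : Matrix (Fin n) (Fin n) k)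
    (hT : T.map φ = M.transpose * M) (hM : ∀ x j, M (τ x) j = M x j) :
    T.rank ≤ permOrbitCount τ := by
  classical
  let Orb := {s : Set (Fin n) // ∃ x : Fin n, s = {y | ∃ k : ℤ, (τ ^ k) x = y}}
  let π : Fin n → Orb := fun x => ⟨_, x, rfl⟩
  have hπ : Function.Surjective π := fun ⟨s, x, hx⟩ => ⟨x, Subtype.ext hx.symm⟩
  have hfin : Finite Orb := Finite.of_surjective π hπ
  let _ : Fintype Orb := Fintype.ofFinite Orb
  choose r hr using hπ
  have hMr (x j : Fin n) : M (r (π x)) j = M x j := by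
    have h1 : x ∈ (π x).1 := ⟨0, by simp⟩
    rw [← hr (π x)] at h1
    obtain ⟨k, hk⟩ := h1
    rw [← Equiv.Perm.apply_zpow_apply_eq τ (fun x => M x j) (fun x => hM x j) k]
    exact congrArg (fun y => M y j) hk
  refine (Matrix.rank_le_of_map_eq_mul φ T (Matrix.of fun i s => ∑ x with π x = s, M x i)
    (Matrix.of fun s j => M (r s) j) ?_).trans_eq (Nat.card_eq_fintype_card (α := Orb)).symm
  rw [hT]
  ext i j
  simp only [Matrix.mul_apply, Matrix.transpose_apply, Matrix.of_apply, Finset.sum_mul]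
  rw [← Finset.sum_fiberwise (s := Finset.univ) (g := π)]
  refine Finset.sum_congr rfl fun s _ => Finset.sum_congr rfl fun x hx => ?_
  rw [← (Finset.mem_filter.1 hx).2, hMr]

open NumberField in
theorem exists_permInd_le_padicValNat_discr {n : ℕ} (K : IntermediateField ℚ Qbar) [NumberField K]
    (G : Subgroup (Equiv.Perm (Fin n))) (hG : HasGalGroup n K G) (p : ℕ) [hp : Fact p.Prime]
    (hpK : (p : ℤ) ∣ discr K) :
    ∃ τ ∈ G, τ ≠ 1 ∧ permInd τ ≤ padicValNat p (discr K).natAbs := by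
  classical
  obtain ⟨e, he⟩ := hG
  have hn : Module.finrank ℚ K = n := by
    rw [← AlgHom.card ℚ K Qbar, Fintype.card_congr e, Fintype.card_fin]
  let L := IntermediateField.normalClosure ℚ K Qbar
  have hLn : NumberField L := ⟨⟩
  have hQ : Normal ℚ Qbar := normal_Qbar
  have hLN : Normal ℚ L := normalClosure.normal ℚ K (AlgebraicClosure ℚ)
  have hLg : IsGalois ℚ L := ⟨⟩
  obtain ⟨P, hP, hpP, g, hg1, hg⟩ := NumberField.exists_inertia_of_dvd_discr L p
    (hpK.trans (discr_dvd_discr K L))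
  let σ : Qbar ≃ₐ[ℚ] Qbar := g.liftNormal Qbar
  have hσ (y : L) : σ (y : Qbar) = (g y : Qbar) := g.liftNormal_commutes Qbar y
  let τ : Equiv.Perm (Fin n) := Equiv.permCongr e (galAct K σ)
  have hτ (x : Fin n) (z : K) : e.symm (τ x) z = σ (e.symm x z) := by
    simp [τ, galAct]
  have hmem (ι : K →ₐ[ℚ] Qbar) (z : K) : ι z ∈ L := ι.fieldRange_le_normalClosure ⟨z, rfl⟩
  let ρ (x : Fin n) : 𝓞 K →+* 𝓞 L :=
    RingOfIntegers.mapRingHom ((e.symm x).codRestrict L.toSubalgebra (hmem (e.symm x)) : K →ₐ[ℚ] L)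
  have hρ (x : Fin n) (z : 𝓞 K) : ((ρ x z : L) : Qbar) = e.symm x z := rfl
  have hρτ (x : Fin n) (z : 𝓞 K) : ρ (τ x) z = g • ρ x z := by
    apply RingOfIntegers.ext
    apply Subtype.ext
    change ((ρ (τ x) z : L) : Qbar) = ((g (ρ x z : L) : L) : Qbar)
    rw [← hσ, hρ, hρ, hτ]
  refine ⟨τ, (he τ).2 ⟨σ, rfl⟩, fun h1 => hg1 ?_, ?_⟩
  · have hle : L ≤ (AlgHom.equalizer σ.toAlgHom (AlgHom.id ℚ Qbar)).toIntermediateField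
        (fun x hx => by simpa [AlgHom.mem_equalizer] using hx) := by
      refine normalClosure_le_iff.2 fun ι => ?_
      rintro _ ⟨z, rfl⟩
      have h2 := hτ (e ι) z
      rw [h1] at h2
      rw [Equiv.Perm.one_apply, e.symm_apply_apply] at h2
      exact h2.symm
    ext y
    exact (hσ y).symm.trans (hle y.2)
  · let b : Module.Basis (Fin n) ℤ (𝓞 K) := Module.finBasisOfFinrankEq ℤ (𝓞 K)
      (by rw [RingOfIntegers.rank, hn])
    let T : Matrix (Fin n) (Fin n) ℤ := Algebra.traceMatrix ℤ b
    have hdet : T.det = discr K := discr_eq_discr K b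
    let _ : Field (𝓞 L ⧸ P) := Ideal.Quotient.field P
    have hch : CharP (𝓞 L ⧸ P) p := by
      rw [CharP.charP_iff_prime_eq_zero hp.out, ← map_natCast (Ideal.Quotient.mk P),
        Ideal.Quotient.eq_zero_iff_mem]
      exact hpP
    have htr (z : 𝓞 K) : ((Algebra.trace ℤ (𝓞 K) z : ℤ) : 𝓞 L) = ∑ x, ρ x z := by
      apply RingOfIntegers.ext
      apply Subtype.ext
      have h2 := trace_eq_sum_embeddings (K := ℚ) Qbar (x := (z : K))
      rw [← Algebra.coe_trace_int, ← e.symm.sum_comp] at h2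
      simpa [hρ] using h2
    have hrank := rank_le_permOrbitCount τ (ZMod.castHom (dvd_refl p) (𝓞 L ⧸ P))
      (T.map (Int.castRingHom (ZMod p)))
      (Matrix.of fun x j => Ideal.Quotient.mk P (ρ x (b j))) (by
        ext i j
        simp only [Matrix.map_apply, Matrix.mul_apply, Matrix.transpose_apply, Matrix.of_apply, T,
          Algebra.traceMatrix_apply, Algebra.traceForm_apply, eq_intCast, map_intCast,
          ← map_mul, ← map_sum, ← htr]) (fun x j => by
        simp only [Matrix.of_apply]
        rw [Ideal.Quotient.eq, hρτ]
        exact hg _)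
    have hdvd := Matrix.pow_dvd_det_of_rank_le p T _ hrank
    rw [hdet, Fintype.card_fin, ← Int.natCast_pow, Int.natCast_dvd] at hdvd
    exact (padicValNat_dvd_iff_le (Int.natAbs_ne_zero.2 (discr_ne_zero K))).1 hdvd

theorem grpInd_le_padicValNat_discr {n : ℕ} (K : IntermediateField ℚ Qbar) [NumberField K]
    (G : Subgroup (Equiv.Perm (Fin n))) (hG : HasGalGroup n K G) (p : ℕ) [hp : Fact p.Prime]
    (hpK : (p : ℤ) ∣ NumberField.discr K) :
    grpInd G ≤ padicValNat p (NumberField.discr K).natAbs := by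
  obtain ⟨τ, h1, h2, h3⟩ := exists_permInd_le_padicValNat_discr K G hG p hpK
  have h4 : grpInd G ≤ permInd τ := Nat.sInf_le ⟨τ, h1, h2, rfl⟩
  exact h4.trans h3

open NumberField InfinitePlace mixedEmbedding MeasureTheory in
open scoped NNReal ENNReal in
theorem NumberField.minkowskiBound_one_lt (K : Type*) [Field K] [NumberField K] (B : ℝ≥0)
    (hB : (2 : ℝ≥0) ^ Module.finrank ℚ K * NNReal.sqrt ‖discr K‖₊ < B) :
    minkowskiBound K ↑1 < (B : ℝ≥0∞) := by
  classical
  refine lt_of_le_of_lt ?_ (ENNReal.coe_lt_coe.mpr hB)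
  rw [minkowskiBound, volume_fundamentalDomain_fractionalIdealLatticeBasis, Units.val_one,
    FractionalIdeal.absNorm_one, Rat.cast_one, ENNReal.ofReal_one, one_mul,
    mixedEmbedding.finrank, volume_fundamentalDomain_latticeBasis, ENNReal.coe_mul,
    ENNReal.coe_pow, ENNReal.coe_ofNat, mul_comm]
  gcongr
  exact mul_le_of_le_one_left zero_le (pow_le_one₀ zero_le (by simp))

open NumberField InfinitePlace mixedEmbedding MeasureTheory in
open scoped NNReal ENNReal in
theorem NumberField.exists_integer_notMem_int_norm_embedding_le (K : Type*) [Field K]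
    [NumberField K] (H : ℝ≥0) (hH : 1 ≤ H)
    (hB : (2 : ℝ≥0) ^ Module.finrank ℚ K * NNReal.sqrt ‖discr K‖₊ <
      H ^ (Module.finrank ℚ K - 1)) :
    ∃ α : 𝓞 K, (∀ z : ℤ, α ≠ z) ∧ ∀ φ : K →+* ℂ, ‖φ α‖ ≤ 2 * H := by
  classical
  have hM := minkowskiBound_one_lt K _ hB
  have hH0 : H ≠ 0 := (zero_lt_one.trans_le hH).ne'
  have hprod (f : InfinitePlace K → ℝ≥0) (w₀ : InfinitePlace K) (h0 : f w₀ ^ mult w₀ * H =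
      H ^ mult w₀) (h1 : ∀ w ≠ w₀, f w = H) :
      ∏ w, f w ^ mult w = H ^ (Module.finrank ℚ K - 1) := by
    have h2 : (∏ w, f w ^ mult w) * H = H ^ Module.finrank ℚ K := by
      rw [← sum_mult_eq, ← Finset.prod_pow_eq_pow_sum,
        ← Finset.mul_prod_erase _ _ (Finset.mem_univ w₀),
        ← Finset.mul_prod_erase _ _ (Finset.mem_univ w₀), mul_right_comm, h0]
      congr 1
      exact Finset.prod_congr rfl fun w hw => by rw [h1 w (Finset.ne_of_mem_erase hw)]
    refine mul_right_cancel₀ hH0 (h2.trans ?_)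
    rw [← pow_succ, Nat.sub_add_cancel Module.finrank_pos]
  obtain ⟨w₀⟩ := (inferInstance : Nonempty (InfinitePlace K))
  obtain ⟨α, h0, h1, h2⟩ : ∃ α : 𝓞 K, α ≠ 0 ∧ (∀ w : InfinitePlace K, w α ≤ 2 * H) ∧
      |(w₀.embedding α).re| < 1 := by
    by_cases hw₀ : IsReal w₀
    · obtain ⟨α, h0, h1⟩ := exists_ne_zero_mem_ringOfIntegers_lt K
        (f := fun w => if w = w₀ then 1 else H) (by
          rw [convexBodyLT_volume, hprod _ w₀ (by simp [mult, hw₀]) (fun w hw => if_neg hw)]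
          refine hM.trans_le (le_mul_of_one_le_left zero_le ?_)
          exact_mod_cast one_le_convexBodyLTFactor K)
      refine ⟨α, h0, fun w => (h1 w).le.trans ?_, ?_⟩
      · have : (1 : ℝ) ≤ H := hH
        split_ifs <;> push_cast <;> linarith
      · have := h1 w₀
        rw [if_pos rfl, ← norm_embedding_eq] at this
        exact (Complex.abs_re_le_norm _).trans_lt this
    · rw [not_isReal_iff_isComplex] at hw₀
      obtain ⟨α, h0, h1, h2, h3⟩ := exists_ne_zero_mem_ringOfIntegers_lt' K
        (f := fun w => if w = w₀ then NNReal.sqrt H else H) ⟨w₀, hw₀⟩ (by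
          rw [convexBodyLT'_volume, hprod _ w₀ (by
            simp [mult, not_isReal_iff_isComplex.2 hw₀, sq]) (fun w hw => if_neg hw)]
          refine hM.trans_le (le_mul_of_one_le_left zero_le ?_)
          exact_mod_cast one_le_convexBodyLT'Factor K)
      refine ⟨α, h0, fun w => ?_, h2⟩
      have hH' : (1 : ℝ) ≤ H := hH
      by_cases hw : w = w₀
      · subst hw
        rw [← norm_embedding_eq]
        refine (Complex.norm_le_abs_re_add_abs_im _).trans ?_
        simp only [if_pos, ← NNReal.coe_pow, NNReal.sq_sqrt] at h3
        linarith
      · have := h1 w hw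
        simp only [if_neg hw] at this
        linarith
  refine ⟨α, fun z hz => ?_, fun φ => ?_⟩
  · subst hz
    simp only [map_intCast, Complex.intCast_re, ← Int.cast_abs] at h2
    have h3 : z = 0 := Int.abs_lt_one_iff.1 (by exact_mod_cast h2)
    exact h0 (by simp [h3])
  · exact h1 (InfinitePlace.mk φ)

open NumberField in
open scoped NNReal in
theorem NumberField.exists_integer_notMem_rat_norm_embedding_le (K : Type*) [Field K]
    [NumberField K] (H : ℝ≥0) (hH : 1 ≤ H)
    (hB : (2 : ℝ≥0) ^ Module.finrank ℚ K * NNReal.sqrt ‖discr K‖₊ <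
      H ^ (Module.finrank ℚ K - 1)) :
    ∃ α : 𝓞 K, (∀ q : ℚ, (α : K) ≠ algebraMap ℚ K q) ∧ (∀ φ : K →+* ℂ, ‖φ α‖ ≤ 5 * H) ∧
      |Algebra.trace ℤ (𝓞 K) α| ≤ Module.finrank ℚ K := by
  obtain ⟨α, h1, h2⟩ := exists_integer_notMem_int_norm_embedding_le K H hH hB
  set n := Module.finrank ℚ K with hn
  have hn0 : 0 < n := Module.finrank_pos
  have hn0' : (0 : ℝ) < n := by exact_mod_cast hn0
  set t := Algebra.trace ℤ (𝓞 K) α with ht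
  have hH' : (1 : ℝ) ≤ H := hH
  have htb : |(t : ℝ)| ≤ n * (2 * H) := by
    have h3 : ((t : ℚ) : ℂ) = ∑ φ : K →ₐ[ℚ] ℂ, φ α := by
      rw [ht, Algebra.coe_trace_int]
      exact trace_eq_sum_embeddings (K := ℚ) ℂ
    have h4 : |(t : ℝ)| = ‖((t : ℚ) : ℂ)‖ := by simp
    rw [h4, h3]
    refine (norm_sum_le _ _).trans ((Finset.sum_le_sum fun φ _ => h2 φ.toRingHom).trans ?_)
    simp [AlgHom.card, hn]
  have hq : |((t / n : ℤ) : ℝ)| ≤ 3 * H := by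
    have h5 : (t : ℝ) = n * (t / n : ℤ) + (t % n : ℤ) := by
      exact_mod_cast (Int.mul_ediv_add_emod t n).symm
    have h6 : (0 : ℝ) ≤ (t % n : ℤ) := by
      exact_mod_cast Int.emod_nonneg t (by positivity)
    have h7 : ((t % n : ℤ) : ℝ) < n := by
      exact_mod_cast Int.emod_lt_of_pos t (by positivity)
    have h8 : (n : ℝ) * |((t / n : ℤ) : ℝ)| ≤ n * (3 * H) := by
      rw [← abs_of_pos hn0', ← abs_mul, abs_of_pos hn0']
      rw [abs_le] at htb ⊢
      constructor <;> nlinarith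
    exact le_of_mul_le_mul_left h8 hn0'
  refine ⟨α - (t / n : ℤ), fun q hq => ?_, fun φ => ?_, ?_⟩
  · have h3 : IsIntegral ℤ q := by
      rw [← isIntegral_algebraMap_iff (algebraMap ℚ K).injective (B := K), ← hq]
      exact RingOfIntegers.isIntegral_coe _
    obtain ⟨z, rfl⟩ := IsIntegrallyClosed.isIntegral_iff.1 h3
    refine h1 (z + (t / n : ℤ)) ?_
    rw [Int.cast_add, ← sub_eq_iff_eq_add]
    apply RingOfIntegers.ext
    rw [hq]
    simp
  · have h3 : φ ((α - (t / n : ℤ) : 𝓞 K) : K) = φ α - ((t / n : ℤ) : ℂ) := by simp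
    rw [h3]
    refine (norm_sub_le _ _).trans ?_
    have h4 : ‖((t / n : ℤ) : ℂ)‖ ≤ 3 * H := by
      rw [Complex.norm_intCast]
      exact hq
    linarith [h2 φ]
  · have h3 : Algebra.trace ℤ (𝓞 K) ((t / n : ℤ) : 𝓞 K) = n * (t / n) := by
      rw [← eq_intCast (algebraMap ℤ (𝓞 K)), Algebra.trace_algebraMap, RingOfIntegers.rank,
        nsmul_eq_mul]
    rw [map_sub, h3, ← ht]
    have h4 := Int.mul_ediv_add_emod t n
    have h5 := Int.emod_nonneg t (b := n) (by positivity)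
    have h6 := Int.emod_lt_of_pos t (b := n) (by positivity)
    rw [abs_le]
    constructor <;> linarith

theorem injective_apply_of_not_hasBlockSystem {n : ℕ} (K : IntermediateField ℚ Qbar)
    [FiniteDimensional ℚ K] (G : Subgroup (Equiv.Perm (Fin n))) (hG : HasGalGroup n K G)
    (hprim : ¬ HasBlockSystem G) (α : K) (hα : ∀ q : ℚ, α ≠ algebraMap ℚ K q) :
    Function.Injective (fun ι : K →ₐ[ℚ] Qbar => ι α) := by
  classical
  by_contra hinj
  refine hprim ?_
  obtain ⟨e, he⟩ := hG
  let V := Set.range (fun ι : K →ₐ[ℚ] Qbar => ι α)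
  have hVf : Finite V := Set.finite_range _
  let c := Finite.equivFin V
  let v (x : Fin n) : V := ⟨e.symm x α, _, rfl⟩
  have hv : Function.Surjective v := fun ⟨_, ι, hι⟩ => ⟨e ι, Subtype.ext (by simpa [v] using hι)⟩
  refine ⟨Nat.card V, fun j => {x | c (v x) = j}, ?_, fun j => ?_, ?_, fun x => ?_, ?_⟩
  · by_contra hlt
    have hsub : Subsingleton V := Finite.card_le_one_iff_subsingleton.1 (by omega)
    have hc (ι : K →ₐ[ℚ] Qbar) : ι α = K.val α :=
      congrArg Subtype.val (Subsingleton.elim (⟨ι α, ι, rfl⟩ : V) ⟨K.val α, K.val, rfl⟩)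
    have htr := trace_eq_sum_embeddings (K := ℚ) Qbar (x := α)
    simp only [hc, Finset.sum_const, Finset.card_univ, AlgHom.card, nsmul_eq_mul] at htr
    have hn0 : (Module.finrank ℚ K : Qbar) ≠ 0 := by
      exact_mod_cast (Module.finrank_pos (R := ℚ) (M := K)).ne'
    refine hα (Algebra.trace ℚ K α / Module.finrank ℚ K) (K.val.injective ?_)
    refine Eq.trans ?_ (K.val.commutes _).symm
    rw [map_div₀, htr, map_natCast, mul_div_cancel_left₀ _ hn0]
    exact rfl
  · obtain ⟨x, hx⟩ := hv (c.symm j)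
    exact ⟨x, (congrArg c hx).trans (c.apply_symm_apply j)⟩
  · simp only [Function.Injective, not_forall] at hinj
    obtain ⟨ι, ι', h1, h2⟩ := hinj
    refine ⟨c ⟨ι α, ι, rfl⟩, ?_⟩
    have hlt : 1 < Set.ncard {x | c (v x) = c ⟨ι α, ι, rfl⟩} :=
      (Set.one_lt_ncard_iff (Set.toFinite _)).2 ⟨e ι, e ι', by simp [v], by simp [v, h1],
        fun h => h2 (e.injective h)⟩
    exact hlt
  · exact ⟨_, rfl, fun _ h => h.symm⟩
  · intro σ hσ i
    obtain ⟨g, rfl⟩ := (he σ).1 hσ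
    have hg (x : Fin n) : e.symm (Equiv.permCongr e (galAct K g) x) α = g (e.symm x α) := by
      simp [galAct]
    obtain ⟨x₀, hx₀⟩ := hv (c.symm i)
    have hi : c (v x₀) = i := (congrArg c hx₀).trans (c.apply_symm_apply i)
    subst hi
    refine ⟨c (v (Equiv.permCongr e (galAct K g) x₀)), ?_⟩
    have key (x : Fin n) : v (Equiv.permCongr e (galAct K g) x) =
        v (Equiv.permCongr e (galAct K g) x₀) ↔ v x = v x₀ := by
      rw [Subtype.ext_iff, Subtype.ext_iff]
      change e.symm (Equiv.permCongr e (galAct K g) x) α =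
        e.symm (Equiv.permCongr e (galAct K g) x₀) α ↔ _
      rw [hg, hg, g.injective.eq_iff]
    ext y
    obtain ⟨x, rfl⟩ := (Equiv.permCongr e (galAct K g)).surjective y
    simp only [Set.mem_image, Set.mem_ofPred_eq, EmbeddingLike.apply_eq_iff_eq, exists_eq_right,
      key]

theorem adjoin_apply_eq_of_injective (K : IntermediateField ℚ Qbar) [FiniteDimensional ℚ K]
    (α : K) (h : Function.Injective (fun ι : K →ₐ[ℚ] Qbar => ι α)) :
    IntermediateField.adjoin ℚ {(α : Qbar)} = K := by
  have h1 := (Field.primitive_element_iff_algHom_eq_of_eval ℚ Qbar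
    (fun x => IsAlgClosed.splits _) α K.val).2 fun ψ hψ => h hψ
  rw [← IntermediateField.lift_adjoin_simple, h1, IntermediateField.lift_top]

theorem prod_X_sub_C_eq_of_sum_pow_eq {F : Type*} [Field F] [CharZero F] {σ : Type*} [Fintype σ]
    (f g : σ → F)
    (h : ∀ k, 0 < k → k ≤ Fintype.card σ → ∑ i, f i ^ k = ∑ i, g i ^ k) :
    ∏ i, (Polynomial.X - Polynomial.C (f i)) = ∏ i, (Polynomial.X - Polynomial.C (g i)) := by
  classical
  have key (k : ℕ) : k ≤ Fintype.card σ → MvPolynomial.aeval f (MvPolynomial.esymm σ ℚ k) =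
      MvPolynomial.aeval g (MvPolynomial.esymm σ ℚ k) := by
    induction k using Nat.strong_induction_on with
    | _ k ih =>
      intro hk
      rcases Nat.eq_zero_or_pos k with rfl | hk0
      · simp
      have hk0' : (k : F) ≠ 0 := by exact_mod_cast hk0.ne'
      apply mul_left_cancel₀ hk0'
      have hN := MvPolynomial.mul_esymm_eq_sum σ ℚ k
      have hf := congrArg (MvPolynomial.aeval f) hN
      have hg := congrArg (MvPolynomial.aeval g) hN
      rw [map_mul, map_natCast] at hf hg
      rw [hf, hg, map_mul, map_mul, map_sum, map_sum]
      simp only [map_pow, map_neg, map_one]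
      congr 1
      refine Finset.sum_congr rfl fun a ha => ?_
      obtain ⟨h1, h2⟩ := Finset.mem_filter.1 ha
      rw [Finset.HasAntidiagonal.mem_antidiagonal] at h1
      simp only [map_mul, map_pow, map_neg, map_one]
      rw [ih a.1 h2 (by omega)]
      congr 1
      simpa [MvPolynomial.psum] using h a.2 (by omega) (by omega)
  have hm (f : σ → F) : ∏ i, (Polynomial.X - Polynomial.C (f i)) =
      ((Finset.univ.val.map f).map fun t => Polynomial.X - Polynomial.C t).prod := by
    rw [Multiset.map_map]
    exact rfl
  rw [hm, hm, Multiset.prod_X_sub_X_eq_sum_esymm, Multiset.prod_X_sub_X_eq_sum_esymm]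
  simp only [Multiset.card_map]
  refine Finset.sum_congr rfl fun j hj => ?_
  have hj' : j ≤ Fintype.card σ := by
    have := Finset.mem_range.1 hj
    rw [Finset.card_val, Finset.card_univ] at this
    omega
  rw [← MvPolynomial.aeval_esymm_eq_multiset_esymm σ ℚ, key j hj',
    MvPolynomial.aeval_esymm_eq_multiset_esymm]

theorem fieldDiscr_eq (K : IntermediateField ℚ Qbar) [hK : NumberField K] :
    fieldDiscr K = NumberField.discr K := by
  have h : FiniteDimensional ℚ K := hK.to_finiteDimensional
  rw [fieldDiscr, dif_pos h]

/-- A bound for the trace of the `(i + 1)`-st power of an integer of small trace in a field of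
degree `n` all of whose conjugates are at most `5 * H` in absolute value. -/
def tracePowBound (n H i : ℕ) : ℕ := if i = 0 then n else n * (5 * H) ^ (i + 1)

open NumberField in
theorem exists_integer_injective_abs_trace_pow_le {n : ℕ} (K : IntermediateField ℚ Qbar)
    [NumberField K] (G : Subgroup (Equiv.Perm (Fin n))) (hG : HasGalGroup n K G)
    (hprim : ¬ HasBlockSystem G) (H : ℕ) (hH : 1 ≤ H)
    (hB : (2 : ℝ) ^ n * √(discr K).natAbs < (H : ℝ) ^ (n - 1)) :
    ∃ α : 𝓞 K, Function.Injective (fun ι : K →ₐ[ℚ] Qbar => ι α) ∧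
      ∀ i : ℕ, |Algebra.trace ℤ (𝓞 K) (α ^ (i + 1))| ≤ tracePowBound n H i := by
  have hn : Module.finrank ℚ K = n := by
    obtain ⟨e, -⟩ := hG
    rw [← AlgHom.card ℚ K Qbar, Fintype.card_congr e, Fintype.card_fin]
  obtain ⟨α, h1, h2, h3⟩ := exists_integer_notMem_rat_norm_embedding_le K H
    (by exact_mod_cast hH) (by
      rw [hn, ← NNReal.coe_lt_coe]
      push_cast
      rwa [Int.norm_eq_abs, ← Int.cast_abs, Int.abs_eq_natAbs, Int.cast_natCast])
  refine ⟨α, injective_apply_of_not_hasBlockSystem K G hG hprim α h1, fun i => ?_⟩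
  rw [tracePowBound]
  split_ifs with hi
  · rw [hi, zero_add, pow_one, ← hn]
    exact h3
  · set t := Algebra.trace ℤ (𝓞 K) (α ^ (i + 1)) with ht
    have h5 : ((t : ℚ) : ℂ) = ∑ φ : K →ₐ[ℚ] ℂ, φ (α ^ (i + 1) : K) := by
      rw [ht, Algebra.coe_trace_int]
      exact trace_eq_sum_embeddings (K := ℚ) ℂ
    have h6 : |(t : ℝ)| = ‖((t : ℚ) : ℂ)‖ := by simp
    have h7 : |(t : ℝ)| ≤ n * (5 * H) ^ (i + 1) := by
      rw [h6, h5]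
      refine (norm_sum_le _ _).trans ((Finset.sum_le_sum fun φ _ => ?_ :
        _ ≤ ∑ φ : K →ₐ[ℚ] ℂ, (5 * H : ℝ) ^ (i + 1)).trans ?_)
      · rw [map_pow, norm_pow]
        gcongr
        exact h2 φ.toRingHom
      · simp [AlgHom.card, hn]
    exact_mod_cast h7

open NumberField in
theorem mem_range_of_trace_pow_eq {n : ℕ} (K K' : IntermediateField ℚ Qbar)
    [NumberField K] [NumberField K'] (hn : Module.finrank ℚ K = n) (hn' : Module.finrank ℚ K' = n)
    (α : 𝓞 K) (α' : 𝓞 K')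
    (h : ∀ i < n, Algebra.trace ℤ (𝓞 K) (α ^ (i + 1)) = Algebra.trace ℤ (𝓞 K') (α' ^ (i + 1))) :
    ∃ ι : K →ₐ[ℚ] Qbar, ι α = ((α' : K') : Qbar) := by
  have hc (K : IntermediateField ℚ Qbar) [NumberField K] (hn : Module.finrank ℚ K = n) :
      Fintype.card (K →ₐ[ℚ] Qbar) = n := by rw [AlgHom.card, hn]
  let e (K : IntermediateField ℚ Qbar) [NumberField K] (hn : Module.finrank ℚ K = n) :=
    Fintype.equivFinOfCardEq (hc K hn)
  have hs (K : IntermediateField ℚ Qbar) [NumberField K] (hn : Module.finrank ℚ K = n)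
      (α : 𝓞 K) (k : ℕ) :
      ∑ x, ((e K hn).symm x α) ^ k = ((Algebra.trace ℤ (𝓞 K) (α ^ k) : ℤ) : Qbar) := by
    rw [(e K hn).symm.sum_comp (fun ι : K →ₐ[ℚ] Qbar => ι α ^ k)]
    have h2 := trace_eq_sum_embeddings (K := ℚ) Qbar (x := ((α ^ k : 𝓞 K) : K))
    rw [← Algebra.coe_trace_int] at h2
    simpa using h2.symm
  have hP := prod_X_sub_C_eq_of_sum_pow_eq (fun x => (e K hn).symm x (α : K))
    (fun x => (e K' hn').symm x (α' : K')) fun k hk0 hk => by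
      obtain ⟨i, rfl⟩ := Nat.exists_eq_add_of_lt hk0
      rw [Fintype.card_fin] at hk
      rw [hs K hn, hs K' hn', zero_add, h i (by omega)]
  obtain ⟨ι₀, hι₀⟩ : ∃ ι : K' →ₐ[ℚ] Qbar, ι (α' : K') = ((α' : K') : Qbar) := ⟨K'.val, rfl⟩
  have h3 := congrArg (Polynomial.eval ((α' : K') : Qbar)) hP
  rw [Polynomial.eval_prod, Polynomial.eval_prod, Finset.prod_eq_zero (i := e K' hn' ι₀)
    (s := Finset.univ) (f := fun x => Polynomial.eval _ (Polynomial.X - Polynomial.C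
      ((e K' hn').symm x (α' : K')))) (Finset.mem_univ _) (by
      rw [Equiv.symm_apply_apply, hι₀]; simp), Finset.prod_eq_zero_iff] at h3
  obtain ⟨x, -, hx⟩ := h3
  refine ⟨(e K hn).symm x, ?_⟩
  rw [Polynomial.eval_sub, Polynomial.eval_X, Polynomial.eval_C, sub_eq_zero] at hx
  exact hx.symm

open NumberField in
theorem card_numberFields_le {n : ℕ} (hn : 0 < n) (G : Subgroup (Equiv.Perm (Fin n)))
    (hprim : ¬ HasBlockSystem G) (H : ℕ) (hH : 1 ≤ H) (P : Finset ℕ) (hP : ∀ p ∈ P, p.Prime)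
    (hPn : ∀ p ∈ P, n < p) (k : ℕ → ℕ) (F : Finset (IntermediateField ℚ Qbar))
    (hF : ∀ K ∈ F, Module.finrank ℚ K = n ∧ HasGalGroup n K G ∧
      (2 : ℝ) ^ n * √(fieldDiscr K).natAbs < (H : ℝ) ^ (n - 1) ∧
      ∀ p ∈ P, padicValNat p (fieldDiscr K).natAbs = k p) :
    (F.card : ℝ) ≤ n * ((residueBound n : ℝ) ^ P.card *
      ∏ i : Fin n, (2 * tracePowBound n H i / indexModulus P n k i + 2 : ℝ)) := by
  classical
  have hnf (K) (hK : K ∈ F) : NumberField K := by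
    have : FiniteDimensional ℚ K := .of_finrank_pos ((hF K hK).1 ▸ hn)
    exact ⟨⟩
  have hex (K : IntermediateField ℚ Qbar) : ∃ (t : Fin n → ℤ) (β : Qbar), K ∈ F →
      ∃ (_ : NumberField K) (α : 𝓞 K), β = (α : K) ∧
        Function.Injective (fun ι : K →ₐ[ℚ] Qbar => ι α) ∧
        (∀ i : Fin n, t i = Algebra.trace ℤ (𝓞 K) (α ^ (i.1 + 1))) ∧
        (∀ i, |t i| ≤ tracePowBound n H i) := by
    by_cases hK : K ∈ F
    · have := hnf K hK
      obtain ⟨h1, h2, h3, h4⟩ := hF K hK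
      rw [fieldDiscr_eq] at h3
      obtain ⟨α, h5, h6⟩ := exists_integer_injective_abs_trace_pow_le K G h2 hprim H hH h3
      exact ⟨fun i => Algebra.trace ℤ (𝓞 K) (α ^ (i.1 + 1)), (α : K), fun _ =>
        ⟨this, α, rfl, h5, fun _ => rfl, fun i => h6 i⟩⟩
    · exact ⟨0, 0, fun h => absurd h hK⟩
  choose t β ht using hex
  have hcard : (F.card : ℝ) ≤ n * (F.image t).card := by
    have h1 : F.card ≤ n * (F.image t).card := by
      refine Finset.card_le_mul_card_image F n fun b hb => ?_
      obtain ⟨K, hK, rfl⟩ := Finset.mem_image.1 hb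
      obtain ⟨hnK, α, hα, -, hαt, -⟩ := ht K hK
      have hc : Fintype.card (K →ₐ[ℚ] Qbar) = n := by rw [AlgHom.card, (hF K hK).1]
      calc _ ≤ (Finset.univ.image fun ι : K →ₐ[ℚ] Qbar =>
            IntermediateField.adjoin ℚ {ι (α : K)}).card := by
            refine Finset.card_le_card fun K' hK' => ?_
            obtain ⟨hK', htt⟩ := Finset.mem_filter.1 hK'
            obtain ⟨hnK', α', hα', hinj', hαt', -⟩ := ht K' hK'
            obtain ⟨ι, hι⟩ := mem_range_of_trace_pow_eq K K' (hF K hK).1 (hF K' hK').1 α α'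
              fun i hi => by
                rw [← hαt ⟨i, hi⟩, ← hαt' ⟨i, hi⟩, htt]
            exact Finset.mem_image.2 ⟨ι, Finset.mem_univ _, by
              rw [hι]; exact adjoin_apply_eq_of_injective K' α' hinj'⟩
        _ ≤ n := by
          rw [← hc]
          exact Finset.card_image_le
    exact_mod_cast h1
  refine hcard.trans (mul_le_mul_of_nonneg_left ?_ (Nat.cast_nonneg n))
  refine card_le_of_isPowerSumTuple n P hP hPn k (fun i => tracePowBound n H i) _
    (fun s hs i => ?_) fun s hs p hp _ => ?_
  · obtain ⟨K, hK, rfl⟩ := Finset.mem_image.1 hs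
    obtain ⟨-, -, -, -, -, h⟩ := ht K hK
    exact h i
  · obtain ⟨K, hK, rfl⟩ := Finset.mem_image.1 hs
    obtain ⟨hnK, α, -, -, h, -⟩ := ht K hK
    simp only [h]
    rw [← (hF K hK).2.2.2 p hp, fieldDiscr_eq]
    exact NumberField.isPowerSumTuple_trace_pow (hF K hK).1 p (hPn p hp) α

theorem prod_indexModulus (P : Finset ℕ) (n : ℕ) (k : ℕ → ℕ) (hk : ∀ p ∈ P, k p ≤ n) :
    ∏ i : Fin n, indexModulus P n k i = ∏ p ∈ P, p ^ k p := by
  rw [Fin.prod_univ_eq_prod_range (indexModulus P n k)]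
  simp only [indexModulus, Finset.prod_filter]
  rw [Finset.prod_comm]
  refine Finset.prod_congr rfl fun p hp => ?_
  rw [← Finset.prod_filter, Finset.prod_const]
  have h1 : {i ∈ Finset.range n | n - k p ≤ i} = Finset.Ico (n - k p) n := by
    ext i
    simp [and_comm]
  rw [h1, Nat.card_Ico, Nat.sub_sub_self (hk p hp)]

theorem indexModulus_pow_le (P : Finset ℕ) (hP : ∀ p ∈ P, p.Prime) (n : ℕ) (k : ℕ → ℕ) (i J : ℕ)
    (hJ : ∀ p ∈ P, n - k p ≤ i → J ≤ k p) :
    indexModulus P n k i ^ J ≤ ∏ p ∈ P, p ^ k p := by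
  rw [indexModulus, ← Finset.prod_pow]
  calc _ ≤ ∏ p ∈ P with n - k p ≤ i, p ^ k p :=
        Finset.prod_le_prod' fun p hp => by
          obtain ⟨h1, h2⟩ := Finset.mem_filter.1 hp
          exact Nat.pow_le_pow_right (hP p h1).pos (hJ p h1 h2)
    _ ≤ _ := Finset.prod_le_prod_of_subset_of_one_le' (Finset.filter_subset _ _) fun p hp _ =>
        Nat.one_le_pow _ _ (hP p hp).pos

theorem indexModulus_le_pow (P : Finset ℕ) (hP : ∀ p ∈ P, p.Prime) (n : ℕ) (k : ℕ → ℕ)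
    (hk : ∀ p ∈ P, 2 ≤ k p ∧ k p < n) (H : ℕ) (hH : 1 ≤ H)
    (hPH : ∏ p ∈ P, p ^ k p ≤ H ^ (2 * (n - 1))) (i : ℕ) (hi0 : i ≠ 0) (hi : i < n) :
    indexModulus P n k i ≤ H ^ (i + 1) := by
  have hJ : 2 * (n - 1) ≤ (i + 1) * max 2 (n - i) := by
    rcases le_total (n - i) 2 with h | h
    · rw [max_eq_left h]
      omega
    · rw [max_eq_right h]
      obtain ⟨j, hj⟩ := Nat.exists_eq_add_of_le h
      obtain ⟨l, rfl⟩ := Nat.exists_eq_add_of_lt (Nat.pos_of_ne_zero hi0)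
      have hn : n = l + j + 3 := by omega
      rw [hj, hn, show l + j + 3 - 1 = l + j + 2 by omega]
      nlinarith [Nat.zero_le (l * j)]
  have h0 : max 2 (n - i) ≠ 0 := by positivity
  rw [← Nat.pow_le_pow_iff_left h0, ← pow_mul]
  refine (indexModulus_pow_le P hP n k i _ fun p hp h => ?_).trans
    (hPH.trans (Nat.pow_le_pow_right hH hJ))
  have := hk p hp
  omega

theorem sum_fin_ite_succ (n : ℕ) (hn : 0 < n) :
    2 * ∑ i : Fin n, (if i.1 = 0 then 0 else i.1 + 1) = (n + 2) * (n - 1) := by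
  rw [Fin.sum_univ_eq_sum_range (fun i => if i = 0 then 0 else i + 1)]
  obtain ⟨m, rfl⟩ := Nat.exists_eq_succ_of_ne_zero hn.ne'
  induction m with
  | zero => simp
  | succ m ih =>
    rw [Finset.sum_range_succ, mul_add, ih (Nat.succ_pos m), if_neg (Nat.succ_ne_zero m)]
    simp only [Nat.succ_eq_add_one, Nat.add_sub_cancel]
    ring

theorem prod_tracePowBound_div_le (n : ℕ) (P : Finset ℕ) (hP : ∀ p ∈ P, p.Prime)
    (k : ℕ → ℕ) (hk : ∀ p ∈ P, 2 ≤ k p ∧ k p < n) (H : ℕ) (hH : 1 ≤ H)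
    (hPH : ∏ p ∈ P, p ^ k p ≤ H ^ (2 * (n - 1))) :
    ∏ i : Fin n, (2 * tracePowBound n H i / indexModulus P n k i + 2 : ℝ) ≤
      (2 * n * 5 ^ n + 2 : ℝ) ^ n * (H : ℝ) ^ (∑ i : Fin n, (if i.1 = 0 then 0 else i.1 + 1)) /
        ∏ p ∈ P, p ^ k p := by
  have hQ0 (i : ℕ) : 0 < indexModulus P n k i := by
    rw [indexModulus]
    exact Finset.prod_pos fun p hp => (hP p (Finset.mem_filter.1 hp).1).pos
  have hfac (i : Fin n) : (2 * tracePowBound n H i / indexModulus P n k i + 2 : ℝ) ≤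
      (2 * n * 5 ^ n + 2 : ℝ) * (H : ℝ) ^ (if i.1 = 0 then 0 else i.1 + 1) /
        indexModulus P n k i := by
    have hQ : (0 : ℝ) < indexModulus P n k i := by exact_mod_cast hQ0 i
    rw [le_div_iff₀ hQ, add_mul, div_mul_cancel₀ _ hQ.ne', tracePowBound]
    split_ifs with hi
    · have h1 : indexModulus P n k i = 1 := by
        rw [indexModulus, Finset.filter_false_of_mem, Finset.prod_empty]
        intro p hp
        have := hk p hp
        omega
      rw [h1]
      push_cast
      have : (1 : ℝ) ≤ 5 ^ n := one_le_pow₀ (by norm_num)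
      nlinarith [Nat.cast_nonneg (α := ℝ) n]
    · have h1 : (indexModulus P n k i : ℝ) ≤ (H : ℝ) ^ (i.1 + 1) := by
        exact_mod_cast indexModulus_le_pow P hP n k hk H hH hPH i hi i.2
      have h2 : (5 : ℝ) ^ (i.1 + 1) ≤ 5 ^ n := pow_le_pow_right₀ (by norm_num) i.2
      push_cast
      rw [mul_pow]
      have h3 : (n : ℝ) * 5 ^ (i.1 + 1) * (H : ℝ) ^ (i.1 + 1) ≤ n * 5 ^ n * (H : ℝ) ^ (i.1 + 1) := by
        gcongr
      linarith
  refine (Finset.prod_le_prod (fun i _ => by positivity) fun i _ => hfac i).trans_eq ?_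
  rw [Finset.prod_div_distrib, Finset.prod_mul_distrib, Finset.prod_const, Finset.card_univ,
    Fintype.card_fin, Finset.prod_pow_eq_pow_sum]
  congr 1
  exact_mod_cast prod_indexModulus P n k fun p hp => (hk p hp).2.le

theorem exists_nat_pow_bounds (n : ℕ) (hn : 2 ≤ n) (Y : ℝ) (hY : 1 ≤ Y) :
    ∃ H : ℕ, 1 ≤ H ∧ (2 : ℝ) ^ n * √Y < (H : ℝ) ^ (n - 1) ∧ Y ≤ (H : ℝ) ^ (2 * (n - 1)) ∧
      ∀ s : ℕ, 2 * s = (n + 2) * (n - 1) →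
        (H : ℝ) ^ s ≤ 3 ^ s * (4 ^ n * Y) ^ (((n : ℝ) + 2) / 4) := by
  have hZ : 1 ≤ 4 ^ n * Y := one_le_mul_of_one_le_of_one_le (one_le_pow₀ (by norm_num)) hY
  have hZ0 : 0 ≤ 4 ^ n * Y := by linarith
  have hn1 : (2 * (n - 1) : ℕ) ≠ 0 := by omega
  set x : ℝ := (4 ^ n * Y) ^ ((2 * (n - 1) : ℕ) : ℝ)⁻¹ with hx
  have hx1 : 1 ≤ x := Real.one_le_rpow hZ (by positivity)
  have hxp : x ^ (2 * (n - 1)) = 4 ^ n * Y := Real.rpow_inv_natCast_pow hZ0 hn1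
  have hxH : x < (⌈x⌉₊ + 1 : ℕ) := by
    push_cast
    linarith [Nat.le_ceil x]
  have hHx : ((⌈x⌉₊ + 1 : ℕ) : ℝ) ≤ 3 * x := by
    push_cast
    linarith [Nat.ceil_lt_add_one (zero_le_one.trans hx1)]
  have hZH : 4 ^ n * Y < ((⌈x⌉₊ + 1 : ℕ) : ℝ) ^ (2 * (n - 1)) := by
    rw [← hxp]
    exact pow_lt_pow_left₀ hxH (zero_le_one.trans hx1) hn1
  refine ⟨⌈x⌉₊ + 1, by omega, ?_, ?_, fun s hs => ?_⟩
  · refine lt_of_pow_lt_pow_left₀ 2 (by positivity) ?_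
    rw [mul_pow, Real.sq_sqrt (by linarith), ← pow_mul, ← pow_mul, mul_comm n 2, pow_mul 2 2 n,
      mul_comm (n - 1) 2]
    norm_num at hZH ⊢
    exact hZH
  · refine le_trans ?_ hZH.le
    exact le_mul_of_one_le_left (by linarith) (one_le_pow₀ (by norm_num))
  · calc ((⌈x⌉₊ + 1 : ℕ) : ℝ) ^ s ≤ (3 * x) ^ s := by gcongr
      _ = 3 ^ s * (4 ^ n * Y) ^ (((n : ℝ) + 2) / 4) := by
        rw [mul_pow, hx, ← Real.rpow_natCast (_ ^ _), ← Real.rpow_mul hZ0]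
        congr 2
        have h1 : (2 * s : ℝ) = (n + 2) * (n - 1) := by
          rw [← Nat.cast_pred (by omega)]
          exact_mod_cast hs
        have h2 : (n : ℝ) - 1 ≠ 0 := by
          have : (2 : ℝ) ≤ n := by exact_mod_cast hn
          linarith
        rw [Nat.cast_mul, Nat.cast_pred (by omega)]
        push_cast
        field_simp
        linarith

theorem exists_card_numberFields_le_rpow (n : ℕ) (hn : 2 ≤ n) :
    ∃ c : ℝ, 0 < c ∧ ∀ G : Subgroup (Equiv.Perm (Fin n)), ¬ HasBlockSystem G →
      ∀ (P : Finset ℕ) (k : ℕ → ℕ) (Y : ℝ) (F : Finset (IntermediateField ℚ Qbar)),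
      (∀ p ∈ P, p.Prime) → (∀ p ∈ P, n < p) → (∀ p ∈ P, 2 ≤ k p ∧ k p < n) → 1 ≤ Y →
      ((∏ p ∈ P, p ^ k p : ℕ) : ℝ) ≤ Y →
      (∀ K ∈ F, Module.finrank ℚ K = n ∧ HasGalGroup n K G ∧ ((fieldDiscr K).natAbs : ℝ) ≤ Y ∧
        ∀ p ∈ P, padicValNat p (fieldDiscr K).natAbs = k p) →
      (F.card : ℝ) ≤ c * (residueBound n : ℝ) ^ P.card * Y ^ (((n : ℝ) + 2) / 4) /
        (∏ p ∈ P, p ^ k p : ℕ) := by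
  set s := ∑ i : Fin n, (if i.1 = 0 then 0 else i.1 + 1) with hs
  refine ⟨n * (2 * n * 5 ^ n + 2 : ℝ) ^ n * 3 ^ s * (4 ^ n) ^ (((n : ℝ) + 2) / 4), by positivity,
    fun G hG P k Y F hP hPn hk hY hPY hF => ?_⟩
  obtain ⟨H, hH, h1, h2, h3⟩ := exists_nat_pow_bounds n hn Y hY
  have h4 := card_numberFields_le (by omega) G hG H hH P hP hPn k F fun K hK => by
    obtain ⟨h5, h6, h7, h8⟩ := hF K hK
    refine ⟨h5, h6, lt_of_le_of_lt ?_ h1, h8⟩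
    gcongr
  have h5 := prod_tracePowBound_div_le n P hP k hk H hH (by exact_mod_cast hPY.trans h2)
  have h6 := h3 s (sum_fin_ite_succ n (by omega))
  rw [Real.mul_rpow (by positivity) (by linarith)] at h6
  have h7 : (0 : ℝ) < ∏ p ∈ P, (p : ℝ) ^ k p :=
    Finset.prod_pos fun p hp => pow_pos (by exact_mod_cast (hP p hp).pos) _
  have h8 : ((∏ p ∈ P, p ^ k p : ℕ) : ℝ) = ∏ p ∈ P, (p : ℝ) ^ k p := by push_cast; rfl
  rw [h8] at h5 ⊢
  calc (F.card : ℝ) ≤ _ := h4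
    _ ≤ n * ((residueBound n : ℝ) ^ P.card * ((2 * n * 5 ^ n + 2 : ℝ) ^ n *
        (3 ^ s * ((4 ^ n) ^ (((n : ℝ) + 2) / 4) * Y ^ (((n : ℝ) + 2) / 4))) /
        ∏ p ∈ P, (p : ℝ) ^ k p)) := by
      gcongr
      refine h5.trans ?_
      gcongr
    _ = _ := by ring

theorem exists_pow_card_primeFactors_le (C : ℕ) (hC : 1 ≤ C) (δ : ℝ) (hδ : 0 < δ) :
    ∃ c : ℝ, 0 < c ∧ ∀ N : ℕ, N ≠ 0 → (C : ℝ) ^ N.primeFactors.card ≤ c * (N : ℝ) ^ δ := by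
  have hC' : (1 : ℝ) ≤ C := by exact_mod_cast hC
  set M := ⌈(C : ℝ) ^ δ⁻¹⌉₊ with hM
  refine ⟨(C : ℝ) ^ M, by positivity, fun N hN => ?_⟩
  have h1 (p : ℕ) (hp : p ∈ N.primeFactors) :
      (C : ℝ) ≤ (if p < M then (C : ℝ) else 1) * (p : ℝ) ^ δ := by
    have hp1 : (1 : ℝ) ≤ p := by exact_mod_cast (Nat.prime_of_mem_primeFactors hp).one_le
    split_ifs with h
    · exact le_mul_of_one_le_right (by positivity) (Real.one_le_rpow hp1 hδ.le)
    · rw [one_mul]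
      have h2 : (C : ℝ) ^ δ⁻¹ ≤ p := (Nat.le_ceil _).trans (by exact_mod_cast not_lt.1 h)
      calc (C : ℝ) = ((C : ℝ) ^ δ⁻¹) ^ δ := by
            rw [← Real.rpow_mul (by positivity), inv_mul_cancel₀ hδ.ne', Real.rpow_one]
        _ ≤ (p : ℝ) ^ δ := Real.rpow_le_rpow (by positivity) h2 hδ.le
  calc (C : ℝ) ^ N.primeFactors.card = ∏ _p ∈ N.primeFactors, (C : ℝ) := by
        rw [Finset.prod_const]
    _ ≤ ∏ p ∈ N.primeFactors, ((if p < M then (C : ℝ) else 1) * (p : ℝ) ^ δ) :=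
        Finset.prod_le_prod (fun _ _ => by positivity) h1
    _ = (C : ℝ) ^ (N.primeFactors.filter (· < M)).card *
        ((∏ p ∈ N.primeFactors, p : ℕ) : ℝ) ^ δ := by
        rw [Finset.prod_mul_distrib, Finset.prod_ite, Finset.prod_const, Finset.prod_const_one,
          mul_one, Real.finsetProd_rpow _ _ fun p _ => Nat.cast_nonneg p, Nat.cast_prod]
    _ ≤ _ := by
        gcongr
        · calc _ ≤ (Finset.range M).card := Finset.card_le_card fun p hp => by
                simpa using (Finset.mem_filter.1 hp).2
            _ = M := Finset.card_range M
        · exact Nat.le_of_dvd (Nat.pos_of_ne_zero hN) (Nat.prod_primeFactors_dvd N)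

theorem card_le_of_prod_primeFactors_eq (n r : ℕ) (D : Finset ℕ)
    (hD : ∀ d ∈ D, d ≠ 0 ∧ ∏ p ∈ d.primeFactors, p = r ∧
      ∀ p ∈ d.primeFactors, d.factorization p < n) :
    D.card ≤ n ^ r.primeFactors.card := by
  classical
  have hpf (d) (hd : d ∈ D) : d.primeFactors = r.primeFactors := by
    rw [← (hD d hd).2.1, Nat.primeFactors_prod fun p hp => Nat.prime_of_mem_primeFactors hp]
  calc D.card ≤ (r.primeFactors.pi fun _ => Finset.range n).card := by
        refine Finset.card_le_card_of_injOn (fun d p _ => d.factorization p) (fun d hd => ?_)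
          fun d hd d' hd' h => ?_
        · refine Finset.mem_coe.2 (Finset.mem_pi.2 fun p hp => Finset.mem_range.2 ?_)
          exact (hD d hd).2.2 p (by rwa [hpf d hd])
        · refine Nat.eq_of_factorization_eq (hD d hd).1 (hD d' hd').1 fun p => ?_
          by_cases hp : p ∈ r.primeFactors
          · exact congrFun (congrFun h p) hp
          · rw [Finsupp.notMem_support_iff.1 (by rwa [Nat.support_factorization, hpf d hd]),
              Finsupp.notMem_support_iff.1 (by rwa [Nat.support_factorization, hpf d' hd'])]
    _ = _ := by simp

theorem exists_card_powerful_le (n m : ℕ) (hn : 1 ≤ n) (hm : 1 ≤ m) (δ : ℝ) (hδ : 0 < δ) :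
    ∃ c : ℝ, 0 < c ∧ ∀ (X : ℝ) (D : Finset ℕ), 1 ≤ X →
      (∀ d ∈ D, d ≠ 0 ∧ (d : ℝ) ≤ X ∧
        ∀ p ∈ d.primeFactors, m ≤ d.factorization p ∧ d.factorization p < n) →
      (D.card : ℝ) ≤ c * X ^ (1 / (m : ℝ) + δ) := by
  classical
  obtain ⟨c, hc, h⟩ := exists_pow_card_primeFactors_le n hn δ hδ
  refine ⟨c, hc, fun X D hX hD => ?_⟩
  have hX0 : 0 < X := by linarith
  set T := Finset.Icc 1 ⌊X ^ (1 / (m : ℝ))⌋₊ with hT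
  have hmaps (d) (hd : d ∈ D) : ∏ p ∈ d.primeFactors, p ∈ T := by
    obtain ⟨h1, h2, h3⟩ := hD d hd
    refine Finset.mem_Icc.2 ⟨Finset.prod_pos fun p hp => (Nat.prime_of_mem_primeFactors hp).pos,
      Nat.le_floor ?_⟩
    have h4 : (∏ p ∈ d.primeFactors, p) ^ m ≤ d := by
      rw [← Finset.prod_pow]
      refine (Finset.prod_le_prod' fun p hp => Nat.pow_le_pow_right
        (Nat.prime_of_mem_primeFactors hp).pos (h3 p hp).1).trans_eq ?_
      exact Nat.prod_factorization_pow_eq_self h1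
    have h5 : (((∏ p ∈ d.primeFactors, p : ℕ) : ℝ)) ^ m ≤ X := by
      refine le_trans ?_ h2
      exact_mod_cast h4
    rw [one_div, Real.le_rpow_inv_iff_of_pos (by positivity) hX0.le (by positivity),
      Real.rpow_natCast]
    exact h5
  have hfib (r) (hr : r ∈ T) :
      (({d ∈ D | ∏ p ∈ d.primeFactors, p = r}).card : ℝ) ≤ c * X ^ δ := by
    obtain ⟨hr1, hr2⟩ := Finset.mem_Icc.1 hr
    have h1 := card_le_of_prod_primeFactors_eq n r {d ∈ D | ∏ p ∈ d.primeFactors, p = r}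
      fun d hd => by
        obtain ⟨h1, h2⟩ := Finset.mem_filter.1 hd
        exact ⟨(hD d h1).1, h2, fun p hp => ((hD d h1).2.2 p hp).2⟩
    have h2 : (r : ℝ) ≤ X := by
      refine ((Nat.le_floor_iff (by positivity)).1 hr2).trans ?_
      refine (Real.rpow_le_rpow_of_exponent_le hX ?_).trans_eq (Real.rpow_one X)
      rw [div_le_one (by positivity)]
      exact_mod_cast hm
    calc _ ≤ (n : ℝ) ^ r.primeFactors.card := by exact_mod_cast h1
      _ ≤ c * (r : ℝ) ^ δ := h r (by omega)
      _ ≤ _ := by gcongr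
  calc (D.card : ℝ) = ∑ r ∈ T, (({d ∈ D | ∏ p ∈ d.primeFactors, p = r}).card : ℝ) := by
        exact_mod_cast Finset.card_eq_sum_card_fiberwise hmaps
    _ ≤ ∑ _r ∈ T, c * X ^ δ := Finset.sum_le_sum hfib
    _ = (⌊X ^ (1 / (m : ℝ))⌋₊ : ℝ) * (c * X ^ δ) := by simp [hT]
    _ ≤ X ^ (1 / (m : ℝ)) * (c * X ^ δ) := by
        gcongr
        exact Nat.floor_le (by positivity)
    _ = _ := by
        rw [Real.rpow_add hX0]
        ring

theorem permInd_pos {n : ℕ} (g : Equiv.Perm (Fin n)) (hg : g ≠ 1) : 0 < permInd g := by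
  classical
  rw [permInd, Nat.sub_pos_iff_lt, permOrbitCount]
  let π : Fin n → {s : Set (Fin n) // ∃ x : Fin n, s = {y | ∃ k : ℤ, (g ^ k) x = y}} :=
    fun x => ⟨_, x, rfl⟩
  have hπ : Function.Surjective π := fun ⟨s, x, hx⟩ => ⟨x, Subtype.ext hx.symm⟩
  have hle := Nat.card_le_card_of_surjective π hπ
  rw [Nat.card_fin] at hle
  refine lt_of_le_of_ne hle fun heq => hg ?_
  have hb := (Nat.bijective_iff_surjective_and_card π).2 ⟨hπ, by rw [Nat.card_fin, heq]⟩
  ext1 x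
  refine hb.1 (Subtype.ext (Set.ext fun y => ⟨?_, ?_⟩))
  · rintro ⟨k, rfl⟩
    exact ⟨k + 1, by rw [zpow_add_one]; rfl⟩
  · rintro ⟨k, rfl⟩
    exact ⟨k - 1, by rw [← Equiv.Perm.mul_apply, zpow_sub_one, inv_mul_cancel_right]; rfl⟩

theorem grpInd_pos {n : ℕ} (hn : 2 ≤ n) (G : Subgroup (Equiv.Perm (Fin n)))
    (hG : IsTransitiveSub G) : 0 < grpInd G := by
  obtain ⟨σ, hσ, hσ'⟩ := hG ⟨0, by omega⟩ ⟨1, by omega⟩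
  have hne : {m : ℕ | ∃ g ∈ G, g ≠ 1 ∧ m = permInd g}.Nonempty := by
    refine ⟨_, σ, hσ, fun h => ?_, rfl⟩
    simp [h] at hσ'
  obtain ⟨g, -, h1, h2⟩ := Nat.sInf_mem hne
  rw [grpInd, h2]
  exact permInd_pos g h1

/-- The largest divisor of `N` all of whose prime factors exceed `n`. -/
noncomputable def roughPart (n N : ℕ) : ℕ := (N.factorization.filter (n < ·)).prod (· ^ ·)

theorem factorization_roughPart (n N : ℕ) :
    (roughPart n N).factorization = N.factorization.filter (n < ·) := by
  rw [roughPart, Nat.prod_pow_factorization_eq_self]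
  intro p hp
  rw [Finsupp.support_filter, Finset.mem_filter] at hp
  exact Nat.prime_of_mem_primeFactors hp.1

theorem mem_primeFactors_roughPart {n N p : ℕ} :
    p ∈ (roughPart n N).primeFactors ↔ p ∈ N.primeFactors ∧ n < p := by
  rw [← Nat.support_factorization, factorization_roughPart, Finsupp.support_filter,
    Finset.mem_filter, Nat.support_factorization]

theorem roughPart_ne_zero (n N : ℕ) : roughPart n N ≠ 0 := by
  rw [roughPart, Finsupp.prod]
  refine Finset.prod_ne_zero_iff.2 fun p hp => pow_ne_zero _ ?_
  rw [Finsupp.support_filter, Finset.mem_filter] at hp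
  exact (Nat.prime_of_mem_primeFactors hp.1).ne_zero

theorem roughPart_mul_eq (n N : ℕ) (hN : N ≠ 0) :
    roughPart n N * ∏ p ∈ N.primeFactors with ¬ n < p, p ^ N.factorization p = N := by
  have h1 : roughPart n N = ∏ p ∈ N.primeFactors with n < p, p ^ N.factorization p := by
    rw [roughPart, Finsupp.prod, Finsupp.support_filter]
    refine Finset.prod_congr rfl fun p hp => ?_
    rw [Finsupp.filter_apply_pos _ _ (Finset.mem_filter.1 hp).2]
  rw [h1, Finset.prod_filter_mul_prod_filter_not]
  exact Nat.prod_factorization_pow_eq_self hN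

theorem roughPart_le (n N : ℕ) (hN : N ≠ 0) : roughPart n N ≤ N :=
  Nat.le_of_dvd (Nat.pos_of_ne_zero hN) ⟨_, (roughPart_mul_eq n N hN).symm⟩

theorem le_roughPart_mul (n N e : ℕ) (hn : 0 < n) (hN : N ≠ 0)
    (he : ∀ p, N.factorization p ≤ e) : N ≤ roughPart n N * (n ^ e) ^ (n + 1) := by
  conv_lhs => rw [← roughPart_mul_eq n N hN]
  refine Nat.mul_le_mul_left _ ?_
  calc _ ≤ ∏ _p ∈ N.primeFactors with ¬ n < _p, n ^ e := by
        refine Finset.prod_le_prod' fun p hp => ?_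
        exact (Nat.pow_le_pow_left (not_lt.1 (Finset.mem_filter.1 hp).2) _).trans
          (Nat.pow_le_pow_right hn (he p))
    _ = (n ^ e) ^ (N.primeFactors.filter (¬ n < ·)).card := Finset.prod_const _
    _ ≤ _ := by
        refine Nat.pow_le_pow_right (by positivity) ?_
        calc _ ≤ (Finset.range (n + 1)).card := Finset.card_le_card fun p hp => by
              have := (Finset.mem_filter.1 hp).2
              simp only [Finset.mem_range]
              omega
          _ = n + 1 := Finset.card_range _

theorem exists_card_numberFields_le_of_grpInd_eq_one (n : ℕ) (hn : 2 ≤ n)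
    (G : Subgroup (Equiv.Perm (Fin n))) (hprim : ¬ HasBlockSystem G) :
    ∃ c : ℝ, 0 < c ∧ ∀ (X : ℝ) (F : Finset (IntermediateField ℚ Qbar)), 1 ≤ X →
      (∀ K ∈ F, Module.finrank ℚ K = n ∧ |(fieldDiscr K : ℝ)| ≤ X ∧ HasGalGroup n K G) →
      (F.card : ℝ) ≤ c * X ^ (((n : ℝ) + 2) / 4) := by
  obtain ⟨c, hc, h⟩ := exists_card_numberFields_le_rpow n hn
  refine ⟨c, hc, fun X F hX hF => ?_⟩
  have := h G hprim ∅ (fun _ => 0) X F (by simp) (by simp) (by simp) hX (by simpa using hX)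
    fun K hK => ⟨(hF K hK).1, (hF K hK).2.2, by
      simpa [Nat.cast_natAbs] using (hF K hK).2.1, by simp⟩
  simpa using this

open NumberField in
theorem exists_card_numberFields_le_of_two_le_grpInd (n : ℕ) (hn : 2 ≤ n)
    (G : Subgroup (Equiv.Perm (Fin n))) (hprim : ¬ HasBlockSystem G) (hG : 2 ≤ grpInd G)
    (ε : ℝ) (hε : 0 < ε) :
    ∃ c : ℝ, 0 < c ∧ ∀ (X : ℝ) (F : Finset (IntermediateField ℚ Qbar)), 1 ≤ X →
      (∀ K ∈ F, Module.finrank ℚ K = n ∧ |(fieldDiscr K : ℝ)| ≤ X ∧ HasGalGroup n K G) →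
      (F.card : ℝ) ≤ c * X ^ (((n : ℝ) + 2) / 4 - 1 + 1 / (grpInd G : ℝ) + ε) := by
  classical
  obtain ⟨c₁, hc₁, h₁⟩ := exists_card_numberFields_le_rpow n hn
  obtain ⟨c₂, hc₂, h₂⟩ := exists_pow_card_primeFactors_le (residueBound n + 1) (by omega) (ε / 2)
    (by positivity)
  obtain ⟨c₃, hc₃, h₃⟩ := exists_card_powerful_le n (grpInd G) (by omega) (by omega) (ε / 2)
    (by positivity)
  set a : ℝ := ((n : ℝ) + 2) / 4 with ha
  have ha1 : 1 ≤ a := by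
    have : (2 : ℝ) ≤ n := by exact_mod_cast hn
    rw [ha]
    linarith
  set W : ℕ := (n ^ (n * n)) ^ (n + 1) with hW
  have hW1 : 1 ≤ W := Nat.one_le_pow _ _ (by positivity)
  refine ⟨c₃ * (c₁ * c₂ * (W : ℝ) ^ a), by positivity, fun X F hX hF => ?_⟩
  have hX0 : 0 < X := by linarith
  let N (K : IntermediateField ℚ Qbar) : ℕ := (fieldDiscr K).natAbs
  let d (K : IntermediateField ℚ Qbar) : ℕ := roughPart n (N K)
  have hN (K) (hK : K ∈ F) : N K ≠ 0 ∧ (N K : ℝ) ≤ X ∧ (∀ p, (N K).factorization p ≤ n * n) ∧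
      ∀ p ∈ (N K).primeFactors, n < p →
        grpInd G ≤ (N K).factorization p ∧ (N K).factorization p < n := by
    obtain ⟨h1, h2, h3⟩ := hF K hK
    have hfd : FiniteDimensional ℚ K := .of_finrank_pos (by omega)
    have hnf : NumberField K := ⟨⟩
    have hNK : N K = (discr K).natAbs := by rw [← fieldDiscr_eq]
    refine ⟨?_, by simpa [N, Nat.cast_natAbs] using h2, fun p => ?_, fun p hp hnp => ?_⟩
    · rw [hNK]
      exact Int.natAbs_ne_zero.2 (discr_ne_zero K)
    · by_cases hp : p.Prime
      · have : Fact p.Prime := ⟨hp⟩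
        rw [Nat.factorization_def _ hp, hNK, ← h1]
        exact NumberField.padicValNat_discr_le K p
      · rw [Nat.factorization_eq_zero_of_not_prime _ hp]
        exact Nat.zero_le _
    · have hpp := Nat.prime_of_mem_primeFactors hp
      have : Fact p.Prime := ⟨hpp⟩
      rw [Nat.factorization_def _ hpp, hNK]
      refine ⟨grpInd_le_padicValNat_discr K G h3 p ?_, ?_⟩
      · rw [Int.natCast_dvd, ← hNK]
        exact Nat.dvd_of_mem_primeFactors hp
      · rw [← h1] at hnp ⊢
        exact NumberField.padicValNat_discr_lt K p hnp
  have hd (K) (hK : K ∈ F) : d K ≠ 0 ∧ (d K : ℝ) ≤ X ∧ ∀ p ∈ (d K).primeFactors,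
      n < p ∧ (d K).factorization p = (N K).factorization p ∧
        grpInd G ≤ (d K).factorization p ∧ (d K).factorization p < n := by
    obtain ⟨h1, h2, -, h3⟩ := hN K hK
    refine ⟨roughPart_ne_zero n _, le_trans ?_ h2, fun p hp => ?_⟩
    · exact_mod_cast roughPart_le n (N K) h1
    · obtain ⟨h4, h5⟩ := mem_primeFactors_roughPart.1 hp
      have h6 : (d K).factorization p = (N K).factorization p := by
        rw [factorization_roughPart, Finsupp.filter_apply_pos _ _ h5]
      exact ⟨h5, h6, h6 ▸ h3 p h4 h5⟩
  have hfib (d₀) (hd₀ : d₀ ∈ F.image d) : (({K ∈ F | d K = d₀}).card : ℝ) ≤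
      c₁ * c₂ * (W : ℝ) ^ a * X ^ (a - 1 + ε / 2) := by
    obtain ⟨K₀, hK₀, rfl⟩ := Finset.mem_image.1 hd₀
    obtain ⟨h0, hdX, h4⟩ := hd K₀ hK₀
    have hd1 : (1 : ℝ) ≤ d K₀ := by exact_mod_cast Nat.one_le_iff_ne_zero.2 h0
    have hd0 : (0 : ℝ) < d K₀ := by linarith
    have hprod : ∏ p ∈ (d K₀).primeFactors, p ^ (d K₀).factorization p = d K₀ :=
      Nat.prod_factorization_pow_eq_self h0
    have hWr : (1 : ℝ) ≤ W := by exact_mod_cast hW1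
    have h5 := h₁ G hprim (d K₀).primeFactors (d K₀).factorization (d K₀ * W) {K ∈ F | d K = d K₀}
      (fun p hp => Nat.prime_of_mem_primeFactors hp) (fun p hp => (h4 p hp).1)
      (fun p hp => ⟨hG.trans (h4 p hp).2.2.1, (h4 p hp).2.2.2⟩)
      (one_le_mul_of_one_le_of_one_le hd1 hWr) (by
        rw [hprod]
        exact le_mul_of_one_le_right hd0.le hWr) fun K hK => by
        obtain ⟨hK, hdK⟩ := Finset.mem_filter.1 hK
        refine ⟨(hF K hK).1, (hF K hK).2.2, ?_, fun p hp => ?_⟩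
        · rw [← hdK]
          exact_mod_cast le_roughPart_mul n (N K) (n * n) (by omega) (hN K hK).1 (hN K hK).2.2.1
        · rw [← hdK] at hp ⊢
          rw [((hd K hK).2.2 p hp).2.1, Nat.factorization_def _ (Nat.prime_of_mem_primeFactors hp)]
    rw [hprod] at h5
    have h6 : (residueBound n : ℝ) ^ (d K₀).primeFactors.card ≤ c₂ * (d K₀ : ℝ) ^ (ε / 2) := by
      refine le_trans ?_ (h₂ _ h0)
      gcongr
      exact_mod_cast Nat.le_succ _
    calc _ ≤ _ := h5
      _ ≤ c₁ * (c₂ * (d K₀ : ℝ) ^ (ε / 2)) * (d K₀ * W) ^ a / d K₀ := by gcongr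
      _ = c₁ * c₂ * (W : ℝ) ^ a * (d K₀ : ℝ) ^ (a - 1 + ε / 2) := by
        rw [Real.mul_rpow hd0.le (by positivity), Real.rpow_add hd0, Real.rpow_sub_one hd0.ne']
        ring
      _ ≤ _ := by
        gcongr
  have hcard := h₃ X (F.image d) hX fun d₀ hd₀ => by
    obtain ⟨K, hK, rfl⟩ := Finset.mem_image.1 hd₀
    obtain ⟨h1, h2, h3⟩ := hd K hK
    exact ⟨h1, h2, fun p hp => (h3 p hp).2.2⟩
  calc (F.card : ℝ) = ∑ d₀ ∈ F.image d, (({K ∈ F | d K = d₀}).card : ℝ) := by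
        exact_mod_cast Finset.card_eq_sum_card_image d F
    _ ≤ ∑ _d₀ ∈ F.image d, c₁ * c₂ * (W : ℝ) ^ a * X ^ (a - 1 + ε / 2) := Finset.sum_le_sum hfib
    _ = ((F.image d).card : ℝ) * (c₁ * c₂ * (W : ℝ) ^ a * X ^ (a - 1 + ε / 2)) := by
        rw [Finset.sum_const, nsmul_eq_mul]
    _ ≤ c₃ * X ^ (1 / (grpInd G : ℝ) + ε / 2) *
          (c₁ * c₂ * (W : ℝ) ^ a * X ^ (a - 1 + ε / 2)) := by gcongr
    _ = c₃ * (c₁ * c₂ * (W : ℝ) ^ a) *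
          (X ^ (1 / (grpInd G : ℝ) + ε / 2) * X ^ (a - 1 + ε / 2)) := by ring
    _ = _ := by
        rw [← Real.rpow_add hX0]
        congr 2
        ring

/-- (Bhargava's bound.) For `n ≥ 2` and `G` a primitive transitive
subgroup of `Sₙ`, `F_n(X;G) ≪_{n,ε} X^{B+ε}` where `B = (n+2)/4 − 1 + 1/ind(G)`. -/
theorem bhargava_primitive_bound (n : ℕ) (hn : 2 ≤ n)
    (G : Subgroup (Equiv.Perm (Fin n)))
    (hprim : IsPrimitiveSub G)
    (ε : ℝ) (hε : 0 < ε) :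
    ∃ c : ℝ, 0 < c ∧ ∀ X : ℝ, 2 ≤ X →
      (FnG n X G : ℝ) ≤
        c * X ^ (((n : ℝ) + 2) / 4 - 1 + 1 / (grpInd G : ℝ) + ε) := by
  classical
  obtain ⟨htr, hbl⟩ := hprim
  obtain ⟨c, hc, h⟩ : ∃ c : ℝ, 0 < c ∧
      ∀ (X : ℝ) (F : Finset (IntermediateField ℚ Qbar)), 1 ≤ X →
      (∀ K ∈ F, Module.finrank ℚ K = n ∧ |(fieldDiscr K : ℝ)| ≤ X ∧ HasGalGroup n K G) →
      (F.card : ℝ) ≤ c * X ^ (((n : ℝ) + 2) / 4 - 1 + 1 / (grpInd G : ℝ) + ε) := by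
    rcases (Nat.succ_le_of_lt (grpInd_pos hn G htr)).eq_or_lt with h1 | h1
    · obtain ⟨c, hc, h⟩ := exists_card_numberFields_le_of_grpInd_eq_one n hn G hbl
      refine ⟨c, hc, fun X F hX hF => (h X F hX hF).trans ?_⟩
      rw [← h1]
      gcongr
      simp [hε.le]
    · exact exists_card_numberFields_le_of_two_le_grpInd n hn G hbl h1 ε hε
  refine ⟨c, hc, fun X hX => ?_⟩
  rw [FnG]
  by_cases hfin : Finite {K : IntermediateField ℚ Qbar //
    Module.finrank ℚ K = n ∧ |(fieldDiscr K : ℝ)| ≤ X ∧ HasGalGroup n K G}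
  · let _ := Fintype.ofFinite {K : IntermediateField ℚ Qbar //
      Module.finrank ℚ K = n ∧ |(fieldDiscr K : ℝ)| ≤ X ∧ HasGalGroup n K G}
    have h2 := h X (Finset.univ.map (Function.Embedding.subtype fun K : IntermediateField ℚ Qbar =>
      Module.finrank ℚ K = n ∧ |(fieldDiscr K : ℝ)| ≤ X ∧ HasGalGroup n K G)) (by linarith)
      fun K hK => by
        obtain ⟨K', -, rfl⟩ := Finset.mem_map.1 hK
        exact K'.2
    rwa [Finset.card_map, Finset.card_univ, ← Nat.card_eq_fintype_card] at h2
  · rw [not_finite_iff_infinite] at hfin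
    rw [Nat.card_eq_zero_of_infinite, Nat.cast_zero]
    positivity
end
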